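/- Let d ≥ 1, let α = (α_1,…,α_d) with 0 < α_i ≤ 1, and set p_0 := max{1/(1+α_i) : i = 1,…,d}. Let γ be a CRF and L the associated cone-like set. Then for every p with p_0 < p ≤ 1 there is a constant c_p such that ‖σ_L^{κ,α,*} f‖_{L_p(G^d)} ≤ c_p ‖f‖_{H_p^γ} for every martingale f ∈ H_p^γ(G^d). -/

import Mathlib

open MeasureTheory Filter Finset ENNReal

noncomputable section

/-- The Walsh group `G`: countable product of copies of `ℤ/2ℤ`. -/
abbrev WG : Type := ℕ → ZMod 2

/-- The normalized Haar measure (= product of uniform coin-toss measures) on `G`. -/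
def μW : Measure WG := Measure.addHaarMeasure ⊤

instance : (μW).Regular := by unfold μW; infer_instance

instance : IsFiniteMeasure μW := by
  constructor
  rw [← TopologicalSpace.PositiveCompacts.coe_top (α := WG)]
  exact IsCompact.measure_lt_top (⊤ : TopologicalSpace.PositiveCompacts WG).isCompact

/-- The product measure on `G^d`. -/
def μD (d : ℕ) : Measure (Fin d → WG) := Measure.pi fun _ => μW

/-- The `k`-th Rademacher function. -/
def rad (k : ℕ) (x : WG) : ℝ := (-1 : ℝ) ^ (x k).val

/-- The Walsh–Paley function of index `n`. -/
def walsh (n : ℕ) (x : WG) : ℝ :=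
  ∏ k ∈ Finset.range n.size, if n.testBit k then rad k x else 1

/-- The Walsh–Kaczmarz function of index `n`; `Nat.log 2 n` is the order `|n|`. -/
def kacz (n : ℕ) (x : WG) : ℝ :=
  if n = 0 then 1 else
    rad (Nat.log 2 n) x *
      (-1 : ℝ) ^ (∑ k ∈ Finset.range (Nat.log 2 n),
        (if n.testBit k then 1 else 0) * (x (Nat.log 2 n - 1 - k)).val)

/-- The `d`-dimensional Walsh–Kaczmarz function. -/
def kaczD (d : ℕ) (m : Fin d → ℕ) (x : Fin d → WG) : ℝ := ∏ i, kacz (m i) (x i)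

/-- Walsh–Paley Dirichlet kernel. -/
def dirW (n : ℕ) (x : WG) : ℝ := ∑ k ∈ Finset.range n, walsh k x

/-- Walsh–Kaczmarz Dirichlet kernel. -/
def dirK (n : ℕ) (x : WG) : ℝ := ∑ k ∈ Finset.range n, kacz k x

/-- `A_j^α = binom (j+α) j`. -/
def Abin (α : ℝ) (j : ℕ) : ℝ := ∏ i ∈ Finset.range j, (α + i + 1) / (i + 1)

/-- One-dimensional Walsh–Paley `(C,α)` kernel. -/
def KW (α : ℝ) (n : ℕ) (x : WG) : ℝ :=
  (Abin α n)⁻¹ * ∑ k ∈ Finset.range (n + 1), Abin (α - 1) (n - k) * dirW k x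

/-- One-dimensional Walsh–Kaczmarz `(C,α)` kernel. -/
def KK (α : ℝ) (n : ℕ) (x : WG) : ℝ :=
  (Abin α n)⁻¹ * ∑ k ∈ Finset.range (n + 1), Abin (α - 1) (n - k) * dirK k x

/-- The `m`-th Walsh–Kaczmarz–Fourier coefficient of `f : G^d → ℝ`. -/
def fCoeff (d : ℕ) (f : (Fin d → WG) → ℝ) (m : Fin d → ℕ) : ℝ :=
  ∫ x, f x * kaczD d m x ∂ μD d

/-- Rectangular partial sum built from an abstract family `c` of Fourier coefficients. -/
def partialSumOf (d : ℕ) (c : (Fin d → ℕ) → ℝ) (k : Fin d → ℕ) (x : Fin d → WG) : ℝ :=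
  ∑ m ∈ Fintype.piFinset (fun i => Finset.range (k i)), c m * kaczD d m x

/-- `(C,α)` (Cesàro) mean of order `n` built from coefficients `c`. -/
def cesaroOf (d : ℕ) (α : Fin d → ℝ) (c : (Fin d → ℕ) → ℝ) (n : Fin d → ℕ)
    (x : Fin d → WG) : ℝ :=
  (∏ i, Abin (α i) (n i))⁻¹ *
    ∑ k ∈ Fintype.piFinset (fun i => Finset.range (n i + 1)),
      (∏ i, Abin (α i - 1) (n i - k i)) * partialSumOf d c k x

/-- A cone-like restriction function (CRF) family `γ = (γ_j)_{j ≠ 0}`. -/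
structure IsCRF (d : ℕ) [NeZero d] (γ : Fin d → ℝ → ℝ) : Prop where
  strictMono : ∀ j : Fin d, j ≠ 0 → StrictMonoOn (γ j) (Set.Ici 1)
  contOn : ∀ j : Fin d, j ≠ 0 → ContinuousOn (γ j) (Set.Ici 1)
  one_le : ∀ j : Fin d, j ≠ 0 → ∀ x : ℝ, 1 ≤ x → 1 ≤ γ j x
  map_one : ∀ j : Fin d, j ≠ 0 → γ j 1 = 1
  tendsto_atTop : ∀ j : Fin d, j ≠ 0 → Tendsto (γ j) atTop atTop
  reg : ∃ ζ : ℝ, 1 < ζ ∧ ∀ j : Fin d, j ≠ 0 → ∃ c₁ c₂ : ℝ, 1 < c₁ ∧ 1 < c₂ ∧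
    ∀ x : ℝ, 1 ≤ x → c₁ * γ j x ≤ γ j (ζ * x) ∧ γ j (ζ * x) ≤ c₂ * γ j x

/-- The cone-like set `L` determined by `γ` and the parameters `β`. -/
def coneLike (d : ℕ) [NeZero d] (γ : Fin d → ℝ → ℝ) (β : Fin d → ℝ) : Set (Fin d → ℕ) :=
  {n | ∀ j : Fin d, j ≠ 0 → (β j)⁻¹ * γ j (n 0) ≤ (n j : ℝ) ∧ (n j : ℝ) ≤ β j * γ j (n 0)}

/-- `bar γ n₁ = (n₁, n₂, …, n_d)` where `n_j = |γ_j(2^{n₁})|` is the order of `γ_j(2^{n₁})`,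
i.e. `2^{n_j} ≤ γ_j(2^{n₁}) < 2^{n_j+1}`. -/
def bar (d : ℕ) [NeZero d] (γ : Fin d → ℝ → ℝ) (n₁ : ℕ) : Fin d → ℕ :=
  fun j => if j = 0 then n₁ else Nat.log 2 ⌊γ j ((2 : ℝ) ^ n₁)⌋₊

/-- The cone-like restricted maximal operator `σ_L^{κ,α,*}` (built from coefficients `c`). -/
def cesaroMaximal (d : ℕ) [NeZero d] (α : Fin d → ℝ) (γ : Fin d → ℝ → ℝ) (β : Fin d → ℝ)
    (c : (Fin d → ℕ) → ℝ) (x : Fin d → WG) : ℝ≥0∞ :=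
  ⨆ n ∈ coneLike d γ β, ENNReal.ofReal |cesaroOf d α c n x|

/-- `L^p`-"norm" (`0 < p < ∞`) of an `ℝ≥0∞`-valued function on `G^d`. -/
def lpNormE (d : ℕ) (p : ℝ) (g : (Fin d → WG) → ℝ≥0∞) : ℝ≥0∞ :=
  (∫⁻ x, g x ^ p ∂ μD d) ^ (1 / p)

/-- The dyadic rectangle `I_{N}(y) = I_{N_1}(y^1) × ⋯ × I_{N_d}(y^d)`. -/
def rectAt (d : ℕ) (N : Fin d → ℕ) (y : Fin d → WG) : Set (Fin d → WG) :=
  {x | ∀ j : Fin d, ∀ i : ℕ, i < N j → x j i = y j i}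

/-- The one-dimensional dyadic interval `I_N = I_N(0)`. -/
def rectW (N : ℕ) : Set WG := {x | ∀ i : ℕ, i < N → x i = 0}

/-- A one-parameter martingale with respect to the filtration
`(F_{bar γ n₁})_{n₁}` generated by the dyadic rectangles `I_{bar γ n₁}(y)`
(measurability w.r.t. this atomic σ-algebra = being constant on its rectangles,
and the martingale property = equality of integrals over the rectangles). -/
structure ConeMartingale (d : ℕ) [NeZero d] (γ : Fin d → ℝ → ℝ) where
  F : ℕ → (Fin d → WG) → ℝ
  integrable : ∀ n₁, Integrable (F n₁) (μD d)
  adapted : ∀ n₁ (x y : Fin d → WG),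
    (∀ j : Fin d, ∀ i : ℕ, i < bar d γ n₁ j → x j i = y j i) → F n₁ x = F n₁ y
  mart : ∀ n₁ m₁, n₁ ≤ m₁ → ∀ y,
    ∫ x in rectAt d (bar d γ n₁) y, F m₁ x ∂ μD d
      = ∫ x in rectAt d (bar d γ n₁) y, F n₁ x ∂ μD d

/-- The Fourier coefficients of a martingale (the integrals `∫ f_k ψ_m` stabilize). -/
def martCoeff (d : ℕ) [NeZero d] (γ : Fin d → ℝ → ℝ) (f : ConeMartingale d γ) (m : Fin d → ℕ) : ℝ :=
  limUnder atTop (fun k => ∫ x, f.F k x * kaczD d m x ∂ μD d)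

/-- The maximal function `f* = sup_{n₁} |f_{bar n₁}|` of a martingale. -/
def martMaximal (d : ℕ) [NeZero d] (γ : Fin d → ℝ → ℝ) (f : ConeMartingale d γ)
    (x : Fin d → WG) : ℝ≥0∞ :=
  ⨆ n₁ : ℕ, ENNReal.ofReal |f.F n₁ x|

/-- The martingale Hardy space "norm" `‖f‖_{H_p^γ} = ‖f*‖_p`. -/
def hardyNorm (d : ℕ) [NeZero d] (γ : Fin d → ℝ → ℝ) (p : ℝ) (f : ConeMartingale d γ) : ℝ≥0∞ :=
  lpNormE d p (martMaximal d γ f)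

/-- A `p`-atom supported on the rectangle `I_N(y)`. -/
structure IsPAtom (d : ℕ) (p : ℝ) (a : (Fin d → WG) → ℝ) (N : Fin d → ℕ)
    (y : Fin d → WG) : Prop where
  measurable : Measurable a
  support : ∀ x, x ∉ rectAt d N y → a x = 0
  bound : ∀ x, |a x| ≤ ((μD d (rectAt d N y)).toReal) ^ (-(1 / p))
  zero : ∫ x, a x ∂ μD d = 0

/-- The conditional-expectation (dyadic average) of `f` at level `N`. -/
def avgAt (d : ℕ) (N : Fin d → ℕ) (f : (Fin d → WG) → ℝ) (x : Fin d → WG) : ℝ :=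
  (2 : ℝ) ^ (∑ j, N j) * ∫ t in rectAt d N x, f t ∂ μD d

/-- `m` is the martingale generated by the integrable function `f`. -/
def inducedLevels (d : ℕ) [NeZero d] (γ : Fin d → ℝ → ℝ) (f : (Fin d → WG) → ℝ)
    (m : ConeMartingale d γ) : Prop :=
  ∀ n₁ x, m.F n₁ x = avgAt d (bar d γ n₁) f x

/-- The martingale maximal function of (the martingale generated by) a function `f`,
`f* = sup_{n₁} |S_{2^{bar γ n₁}} f|`. -/
def funMaximal (d : ℕ) [NeZero d] (γ : Fin d → ℝ → ℝ) (f : (Fin d → WG) → ℝ)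
    (x : Fin d → WG) : ℝ≥0∞ :=
  ⨆ n₁ : ℕ, ENNReal.ofReal |partialSumOf d (fCoeff d f) (fun j => 2 ^ bar d γ n₁ j) x|

/-- The Hardy norm `‖f‖_{H_p^γ}` of (the martingale generated by) a function `f`. -/
def funHardyNorm (d : ℕ) [NeZero d] (γ : Fin d → ℝ → ℝ) (p : ℝ) (f : (Fin d → WG) → ℝ) : ℝ≥0∞ :=
  lpNormE d p (funMaximal d γ f)

/-- Skvortsov's bit-reversal transformation `τ_A`. -/
def tau (A : ℕ) (x : WG) : WG := fun i => if i < A then x (A - 1 - i) else x i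

end

noncomputable section

lemma rad_of_eq_zero {k : ℕ} {x : WG} (h : x k = 0) : rad k x = 1 := by simp [rad, h]

lemma rad_of_ne_zero {k : ℕ} {x : WG} (h : x k ≠ 0) : rad k x = -1 := by
  have : x k = 1 := by
    generalize x k = a at h ⊢
    revert h; revert a; decide
  simp [rad, this, ZMod.val_one]

lemma abs_rad (k : ℕ) (x : WG) : |rad k x| = 1 := by
  by_cases h : x k = 0
  · simp [rad_of_eq_zero h]
  · simp [rad_of_ne_zero h]

lemma rad_add (k : ℕ) (x y : WG) : rad k (x + y) = rad k x * rad k y := by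
  have h : ∀ a b : ZMod 2, (a + b).val % 2 = (a.val + b.val) % 2 := by decide
  rw [rad, rad, rad, ← pow_add, neg_one_pow_eq_pow_mod_two, Pi.add_apply, h,
    ← neg_one_pow_eq_pow_mod_two]

/-- The Walsh function with the first `j` binary digits of `m` matched to the coordinates of `x`
below `j` in reversed order. -/
def revChar (j m : ℕ) (x : WG) : ℝ :=
  ∏ k ∈ Finset.range j, if m.testBit k then rad (j - 1 - k) x else 1

lemma revChar_congr {j m m' : ℕ} (h : ∀ k < j, m.testBit k = m'.testBit k) (x : WG) :
    revChar j m x = revChar j m' x := by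
  refine Finset.prod_congr rfl fun k hk => ?_
  rw [h k (Finset.mem_range.1 hk)]

lemma revChar_succ (j m : ℕ) (x : WG) :
    revChar (j + 1) m x = (if m.testBit 0 then rad j x else 1) * revChar j (m / 2) x := by
  rw [revChar, Finset.prod_range_succ', mul_comm]
  congr 1
  refine Finset.prod_congr rfl fun k _ => ?_
  rw [Nat.testBit_add_one, show j + 1 - 1 - (k + 1) = j - 1 - k by omega]

lemma revChar_add (j m : ℕ) (x y : WG) : revChar j m (x + y) = revChar j m x * revChar j m y := by
  rw [revChar, revChar, revChar, ← Finset.prod_mul_distrib]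
  refine Finset.prod_congr rfl fun k _ => ?_
  split_ifs <;> simp [rad_add]

lemma kacz_of_ne_zero {m : ℕ} (hm : m ≠ 0) (x : WG) :
    kacz m x = rad (Nat.log 2 m) x * revChar (Nat.log 2 m) m x := by
  rw [kacz, if_neg hm, revChar, ← Finset.prod_pow_eq_pow_sum]
  congr 1
  refine Finset.prod_congr rfl fun k _ => ?_
  split_ifs <;> simp [rad]

lemma kacz_two_pow_add {j m : ℕ} (hm : m < 2 ^ j) (x : WG) :
    kacz (2 ^ j + m) x = rad j x * revChar j m x := by
  have hlog : Nat.log 2 (2 ^ j + m) = j :=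
    (Nat.log_eq_iff (Or.inr ⟨one_lt_two, by positivity⟩)).2
      ⟨Nat.le_add_right _ _, by rw [pow_succ]; omega⟩
  rw [kacz_of_ne_zero (by positivity), hlog]
  congr 1
  exact revChar_congr (fun k hk => Nat.testBit_two_pow_add_gt hk m) x

lemma kacz_add (m : ℕ) (x y : WG) : kacz m (x + y) = kacz m x * kacz m y := by
  rcases eq_or_ne m 0 with rfl | hm
  · simp [kacz]
  · simp only [kacz_of_ne_zero hm, rad_add, revChar_add]
    ring

lemma abs_revChar (j m : ℕ) (x : WG) : |revChar j m x| = 1 := by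
  rw [revChar, Finset.abs_prod]
  refine Finset.prod_eq_one fun k _ => ?_
  split_ifs <;> simp [abs_rad]

lemma abs_kacz (m : ℕ) (x : WG) : |kacz m x| = 1 := by
  rcases eq_or_ne m 0 with rfl | hm
  · simp [kacz]
  · rw [kacz_of_ne_zero hm, abs_mul, abs_rad, abs_revChar, one_mul]

lemma rad_congr {k : ℕ} {x y : WG} (h : x k = y k) : rad k x = rad k y := by simp [rad, h]

lemma kacz_congr {m N : ℕ} (hm : m < 2 ^ N) {x y : WG} (h : ∀ i < N, x i = y i) :
    kacz m x = kacz m y := by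
  rcases eq_or_ne m 0 with rfl | hm0
  · simp [kacz]
  have hlog : Nat.log 2 m < N := Nat.log_lt_of_lt_pow hm0 hm
  rw [kacz_of_ne_zero hm0, kacz_of_ne_zero hm0, rad_congr (h _ hlog)]
  congr 1
  refine Finset.prod_congr rfl fun k hk => ?_
  rw [rad_congr (h _ (by omega))]

lemma sum_range_two_mul {M : Type*} [AddCommMonoid M] (f : ℕ → M) (n : ℕ) :
    ∑ m ∈ Finset.range (2 * n), f m = ∑ m ∈ Finset.range n, (f (2 * m) + f (2 * m + 1)) := by
  induction n with
  | zero => simp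
  | succ n ih =>
    rw [mul_add, mul_one, Finset.sum_range_succ, Finset.sum_range_succ, ih,
      Finset.sum_range_succ, add_assoc]

/-- `∑_{m < 2^j} b m * revChar j m x`, organized by successive pairing of neighbours. -/
def charSum : ℕ → (ℕ → ℝ) → WG → ℝ
  | 0, b, _ => b 0
  | j + 1, b, x => charSum j (fun m => b (2 * m) + rad j x * b (2 * m + 1)) x

lemma charSum_eq (j : ℕ) (b : ℕ → ℝ) (x : WG) :
    charSum j b x = ∑ m ∈ Finset.range (2 ^ j), b m * revChar j m x := by
  induction j generalizing b with
  | zero => simp [charSum, revChar]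
  | succ j ih =>
    rw [charSum, ih, pow_succ', sum_range_two_mul]
    refine Finset.sum_congr rfl fun m _ => ?_
    have h1 : (2 * m + 1) / 2 = m := by omega
    have h2 : (2 * m) / 2 = m := by omega
    have h3 : (2 * m + 1).testBit 0 = true := by simp [Nat.testBit_zero]
    have h4 : (2 * m).testBit 0 = false := by simp [Nat.testBit_zero]
    rw [revChar_succ, revChar_succ, h1, h2, h3, h4]
    simp
    ring

lemma abs_charSum_le (j : ℕ) (b : ℕ → ℝ) (x : WG) :
    |charSum j b x| ≤ ∑ m ∈ Finset.range (2 ^ j), |b m| := by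
  rw [charSum_eq]
  refine (Finset.abs_sum_le_sum_abs _ _).trans (Finset.sum_le_sum fun m _ => ?_)
  rw [abs_mul, abs_revChar, mul_one]

lemma charSum_of_eq_zero {j : ℕ} (b : ℕ → ℝ) {x : WG} (hx : ∀ i < j, x i = 0) :
    charSum j b x = ∑ m ∈ Finset.range (2 ^ j), b m := by
  rw [charSum_eq]
  refine Finset.sum_congr rfl fun m _ => ?_
  rw [revChar, Finset.prod_eq_one, mul_one]
  intro k hk
  rw [rad_of_eq_zero (hx _ (by have := Finset.mem_range.1 hk; omega)), ite_self]

lemma sum_range_two_pow_kacz (c : ℕ → ℝ) (x : WG) (J : ℕ) :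
    ∑ m ∈ Finset.range (2 ^ J), c m * kacz m x =
      c 0 + ∑ j ∈ Finset.range J, rad j x * charSum j (fun m => c (2 ^ j + m)) x := by
  induction J with
  | zero => simp [kacz]
  | succ J ih =>
    rw [Finset.sum_range_succ, ← add_assoc, ← ih, pow_succ, mul_two, Finset.sum_range_add]
    congr 1
    rw [charSum_eq, Finset.mul_sum]
    refine Finset.sum_congr rfl fun m hm => ?_
    rw [kacz_two_pow_add (Finset.mem_range.1 hm)]
    ring

/-- `2^{-α u}`, where `u` is one more than the position of the last nonzero coordinate of `x`
below `j` (and `0` if there is none). -/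
def tailW (α : ℝ) : ℕ → WG → ℝ
  | 0, _ => 1
  | j + 1, x => if x j = 0 then tailW α j x else (2 : ℝ) ^ (-(α * (j + 1)))

/-- `2^{j - u - α v}`, where `u` and `v` are one more than the positions of the last and the
second to last nonzero coordinates of `x` below `j` (and `0` if there are none). -/
def tailU (α : ℝ) : ℕ → WG → ℝ
  | 0, _ => 1
  | j + 1, x => if x j = 0 then 2 * tailU α j x else tailW α j x

/-- The Dirichlet kernel of index `2^j`. -/
def dirPow : ℕ → WG → ℝ
  | 0, _ => 1
  | j + 1, x => if x j = 0 then 2 * dirPow j x else 0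

lemma tailW_pos (α : ℝ) (j : ℕ) (x : WG) : 0 < tailW α j x := by
  induction j with
  | zero => simp [tailW]
  | succ j ih => rw [tailW]; split_ifs <;> positivity

lemma tailU_pos (α : ℝ) (j : ℕ) (x : WG) : 0 < tailU α j x := by
  induction j with
  | zero => simp [tailU]
  | succ j ih => rw [tailU]; have := tailW_pos α j x; split_ifs <;> positivity

lemma rpow_le_tailW {α : ℝ} (hα : 0 ≤ α) (j : ℕ) (x : WG) :
    (2 : ℝ) ^ (-(α * j)) ≤ tailW α j x := by
  induction j with
  | zero => simp [tailW]
  | succ j ih =>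
    rw [tailW]
    split_ifs
    · refine le_trans (Real.rpow_le_rpow_of_exponent_le one_le_two ?_) ih
      push_cast; nlinarith
    · push_cast; exact le_rfl

lemma tailW_le_tailU {α : ℝ} (hα : 0 ≤ α) (j : ℕ) (x : WG) : tailW α j x ≤ tailU α j x := by
  induction j with
  | zero => simp [tailW, tailU]
  | succ j ih =>
    rw [tailW, tailU]
    split_ifs
    · linarith [tailU_pos α j x]
    · refine le_trans (Real.rpow_le_rpow_of_exponent_le one_le_two ?_) (rpow_le_tailW hα j x)
      nlinarith

lemma dirPow_nonneg (j : ℕ) (x : WG) : 0 ≤ dirPow j x := by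
  induction j with
  | zero => simp [dirPow]
  | succ j ih => rw [dirPow]; split_ifs <;> positivity

lemma dirPow_le_tailU (α : ℝ) (j : ℕ) (x : WG) : dirPow j x ≤ tailU α j x := by
  induction j with
  | zero => simp [dirPow, tailU]
  | succ j ih =>
    rw [dirPow, tailU]
    split_ifs
    · linarith
    · exact (tailW_pos α j x).le

lemma dirPow_of_eq_zero {j : ℕ} {x : WG} (hx : ∀ i < j, x i = 0) : dirPow j x = 2 ^ j := by
  induction j with
  | zero => simp [dirPow]
  | succ j ih =>
    rw [dirPow, if_pos (hx j (Nat.lt_succ_self j)), ih fun i hi => hx i (by omega), pow_succ']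

lemma dirPow_of_exists_ne {j : ℕ} {x : WG} (hx : ∃ i < j, x i ≠ 0) : dirPow j x = 0 := by
  induction j with
  | zero => simp at hx
  | succ j ih =>
    rw [dirPow]
    split_ifs with h
    · obtain ⟨i, hi, hne⟩ := hx
      have : i ≠ j := by rintro rfl; exact hne h
      rw [ih ⟨i, by omega, hne⟩, mul_zero]
    · rfl

lemma rad_mul_dirPow (j : ℕ) (x : WG) : rad j x * dirPow j x = dirPow (j + 1) x - dirPow j x := by
  rw [dirPow]
  split_ifs with h
  · rw [rad_of_eq_zero h]; ring
  · rw [rad_of_ne_zero h]; ring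

/-- A nonnegative sequence which increases up to index `M - 1` and vanishes from `M + 2` on. -/
structure RisesThenVanishes (e : ℕ → ℝ) (M : ℕ) : Prop where
  nonneg : ∀ q, 0 ≤ e q
  mono : ∀ q, q + 1 < M → e q ≤ e (q + 1)
  vanish : ∀ q, M + 2 ≤ q → e q = 0

namespace RisesThenVanishes

variable {e : ℕ → ℝ} {M : ℕ}

lemma le_of_le (h : RisesThenVanishes e M) {p q : ℕ} (hpq : p ≤ q) (hq : q < M) : e p ≤ e q := by
  induction q, hpq using Nat.le_induction with
  | base => exact le_rfl
  | succ q _ ih => exact (ih (by omega)).trans (h.mono q hq)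

lemma pair_add (h : RisesThenVanishes e M) :
    RisesThenVanishes (fun m => e (2 * m) + e (2 * m + 1)) (M / 2) where
  nonneg q := add_nonneg (h.nonneg _) (h.nonneg _)
  mono q hq := add_le_add (h.le_of_le (by omega) (by omega)) (h.le_of_le (by omega) (by omega))
  vanish q hq := by rw [h.vanish _ (by omega), h.vanish _ (by omega), add_zero]

lemma even (h : RisesThenVanishes e M) :
    RisesThenVanishes (fun m => e (2 * m)) ((M + 1) / 2) where
  nonneg q := h.nonneg _
  mono q hq := h.le_of_le (by omega) (by omega)
  vanish q hq := h.vanish _ (by omega)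

lemma second_pair_add (h : RisesThenVanishes e M) :
    RisesThenVanishes (fun m => e (2 * m) + 2 * e (2 * m + 1) + e (2 * m + 2)) ((M - 1) / 2) where
  nonneg q := by have := h.nonneg (2 * q); have := h.nonneg (2 * q + 1)
                 have := h.nonneg (2 * q + 2); positivity
  mono q hq := by
    have h1 : e (2 * q) ≤ e (2 * (q + 1)) := h.le_of_le (by omega) (by omega)
    have h2 : e (2 * q + 1) ≤ e (2 * (q + 1) + 1) := h.le_of_le (by omega) (by omega)
    have h3 : e (2 * q + 2) ≤ e (2 * (q + 1) + 2) := h.le_of_le (by omega) (by omega)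
    linarith
  vanish q hq := by
    rw [h.vanish _ (by omega), h.vanish _ (by omega), h.vanish _ (by omega)]; norm_num

lemma sum_abs_sub_le (h : RisesThenVanishes e M) {K : ℝ} (hK : ∀ q, e q ≤ K) (J : ℕ) :
    ∑ m ∈ Finset.range J, |e (2 * m) - e (2 * m + 1)| ≤ 3 * K := by
  have hle : ∀ m, |e (2 * m) - e (2 * m + 1)| ≤ K := fun m =>
    abs_sub_le_of_nonneg_of_le (h.nonneg _) (hK _) (h.nonneg _) (hK _)
  have hrise : ∀ J, J ≤ M / 2 →
      ∑ m ∈ Finset.range J, |e (2 * m) - e (2 * m + 1)| ≤ e (2 * J - 1) := by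
    intro J
    induction J with
    | zero => intro _; simpa using h.nonneg 0
    | succ J ih =>
      intro hJ
      have h1 : e (2 * J - 1) ≤ e (2 * J) := h.le_of_le (by omega) (by omega)
      have h2 : e (2 * J) ≤ e (2 * J + 1) := h.le_of_le (by omega) (by omega)
      rw [Finset.sum_range_succ, abs_of_nonpos (by linarith)]
      have := ih (by omega)
      rw [show 2 * (J + 1) - 1 = 2 * J + 1 by omega]
      linarith
  have htail : ∀ i, ∑ m ∈ Finset.range (M / 2 + 2 + i), |e (2 * m) - e (2 * m + 1)| ≤ 3 * K := by
    intro i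
    induction i with
    | zero =>
      rw [add_zero, Finset.sum_range_succ, Finset.sum_range_succ]
      have := hrise (M / 2) le_rfl
      linarith [hK (2 * (M / 2) - 1), hle (M / 2), hle (M / 2 + 1)]
    | succ i ih =>
      rw [← add_assoc, Finset.sum_range_succ, h.vanish (2 * (M / 2 + 2 + i)) (by omega),
        h.vanish (2 * (M / 2 + 2 + i) + 1) (by omega)]
      simpa using ih
  refine le_trans (Finset.sum_le_sum_of_subset_of_nonneg ?_ fun _ _ _ => abs_nonneg _) (htail J)
  exact Finset.range_mono (by omega)

end RisesThenVanishes

lemma two_rpow_mul_nat_succ (α : ℝ) (j : ℕ) :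
    (2 : ℝ) ^ (α * ((j + 1 : ℕ) : ℝ)) = 2 ^ α * 2 ^ (α * (j : ℝ)) := by
  rw [← Real.rpow_add two_pos]; push_cast; ring_nf

lemma abs_charSum_le_tailW {α : ℝ} (j : ℕ) {e : ℕ → ℝ} {M : ℕ}
    (h : RisesThenVanishes e M) {K : ℝ}
    (hK : ∀ q r : ℕ, ∑ i ∈ Finset.range r, e (q + i) ≤ K * (r : ℝ) ^ α) (x : WG) :
    |charSum j e x| ≤ 3 * K * 2 ^ (α * (j : ℝ)) * tailW α j x := by
  induction j generalizing e M K with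
  | zero =>
    have h1 := hK 0 1
    simp at h1
    simp only [charSum, tailW]
    rw [abs_of_nonneg (h.nonneg 0)]
    have := h.nonneg 0
    norm_num
    linarith
  | succ j ih =>
    rw [charSum, tailW]
    split_ifs with hx
    · have h2 := ih (e := fun m => e (2 * m) + rad j x * e (2 * m + 1)) (M := M / 2)
        (K := 2 ^ α * K) (by simpa [rad_of_eq_zero hx] using h.pair_add) (fun q r => ?_)
      · refine h2.trans_eq ?_
        rw [two_rpow_mul_nat_succ]; ring
      · have := hK (2 * q) (2 * r)
        rw [sum_range_two_mul] at this
        push_cast at this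
        rw [Real.mul_rpow two_pos.le (Nat.cast_nonneg r)] at this
        simp only [rad_of_eq_zero hx, one_mul]
        refine le_trans (le_of_eq ?_) (this.trans_eq (by ring))
        refine Finset.sum_congr rfl fun i _ => ?_
        rw [show 2 * (q + i) = 2 * q + 2 * i by ring, add_assoc (2 * q)]
    · simp only [rad_of_ne_zero hx]
      refine (abs_charSum_le _ _ _).trans ?_
      have hmax : ∀ q, e q ≤ K := fun q => by simpa using hK q 1
      have := h.sum_abs_sub_le hmax (2 ^ j)
      have h3 : (2 : ℝ) ^ (α * ((j + 1 : ℕ) : ℝ)) * 2 ^ (-(α * ((j : ℝ) + 1))) = 1 := by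
        rw [← Real.rpow_add two_pos]; push_cast; simp
      rw [mul_assoc, h3, mul_one]
      simpa [sub_eq_add_neg] using this

lemma abs_charSum_le_tailU {α : ℝ} (j : ℕ) {b : ℕ → ℝ} {M : ℕ}
    (h : RisesThenVanishes (fun m => b m - b (m + 1)) M) {K : ℝ}
    (hK : ∀ q r : ℕ, b q - b (q + r) ≤ K * (r : ℝ) ^ α) {x : WG} (hx : ∃ i < j, x i ≠ 0) :
    |charSum j b x| ≤ 3 * K * 2 ^ (α * (j : ℝ)) * tailU α j x := by
  induction j generalizing b M K with
  | zero => simp at hx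
  | succ j ih =>
    rw [charSum, tailU]
    split_ifs with hxj
    · have h2 := ih (b := fun m => b (2 * m) + rad j x * b (2 * m + 1)) (M := (M - 1) / 2)
        (K := 2 * (2 ^ α * K)) ?_ (fun q r => ?_) ?_
      · refine h2.trans_eq ?_
        rw [two_rpow_mul_nat_succ]; ring
      · simp only [rad_of_eq_zero hxj, one_mul]
        convert h.second_pair_add using 2 with m
        simp only [show 2 * (m + 1) = 2 * m + 1 + 1 by ring]
        ring
      · have h3 := hK (2 * q) (2 * r)
        have h4 := hK (2 * q + 1) (2 * r)
        push_cast at h3 h4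
        rw [Real.mul_rpow two_pos.le (Nat.cast_nonneg r)] at h3 h4
        simp only [rad_of_eq_zero hxj, one_mul]
        rw [show 2 * (q + r) + 1 = 2 * q + 1 + 2 * r by ring, mul_add]
        linarith
      · obtain ⟨i, hi, hne⟩ := hx
        have : i ≠ j := by rintro rfl; exact hne hxj
        exact ⟨i, by omega, hne⟩
    · simp only [rad_of_ne_zero hxj, neg_one_mul, ← sub_eq_add_neg]
      have h2 := abs_charSum_le_tailW (α := α) j (e := fun m => b (2 * m) - b (2 * m + 1))
        (M := (M + 1) / 2) (K := 2 ^ α * K) h.even (fun q r => ?_) x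
      · refine h2.trans_eq ?_
        rw [two_rpow_mul_nat_succ]; ring
      · have h3 := hK (2 * q) (2 * r)
        push_cast at h3
        rw [Real.mul_rpow two_pos.le (Nat.cast_nonneg r)] at h3
        refine le_trans ?_ (h3.trans_eq (by ring))
        clear h3
        induction r with
        | zero => simp
        | succ r ihr =>
          rw [Finset.sum_range_succ, show 2 * (q + r) = 2 * q + 2 * r by ring,
            show 2 * q + 2 * (r + 1) = 2 * q + 2 * r + 1 + 1 by ring]
          have := h.nonneg (2 * q + 2 * r + 1)
          linarith

lemma abs_charSum_sub_le {α : ℝ} (j : ℕ) {b : ℕ → ℝ} {M : ℕ}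
    (h : RisesThenVanishes (fun m => b m - b (m + 1)) M) {K : ℝ}
    (hK : ∀ q r : ℕ, b q - b (q + r) ≤ K * (r : ℝ) ^ α) (x : WG) :
    |charSum j b x - b 0 * dirPow j x| ≤ 3 * K * 2 ^ (α * (j : ℝ)) * tailU α j x := by
  by_cases hx : ∃ i < j, x i ≠ 0
  · simpa [dirPow_of_exists_ne hx] using abs_charSum_le_tailU j h hK hx
  · push Not at hx
    have hanti : Antitone b := antitone_nat_of_succ_le fun m => by
      have := h.nonneg m
      linarith
    have hd : (2 : ℝ) ^ j ≤ tailU α j x := by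
      rw [← dirPow_of_eq_zero hx]; exact dirPow_le_tailU α j x
    have hpow : ((2 ^ j : ℕ) : ℝ) ^ α = 2 ^ (α * (j : ℝ)) := by
      rw [Nat.cast_pow, Nat.cast_ofNat, ← Real.rpow_natCast, ← Real.rpow_mul two_pos.le, mul_comm]
    have hK0 := hK 0 (2 ^ j)
    rw [zero_add, hpow] at hK0
    have h0 : 0 ≤ b 0 - b (2 ^ j) := sub_nonneg.2 (hanti (Nat.zero_le _))
    have hsum : charSum j b x - b 0 * dirPow j x = -∑ m ∈ Finset.range (2 ^ j), (b 0 - b m) := by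
      rw [charSum_of_eq_zero b hx, dirPow_of_eq_zero hx, Finset.sum_sub_distrib]
      simp
      ring
    rw [hsum, abs_neg, abs_of_nonneg (Finset.sum_nonneg fun m _ =>
      sub_nonneg.2 (hanti (Nat.zero_le _)))]
    calc ∑ m ∈ Finset.range (2 ^ j), (b 0 - b m)
        ≤ ∑ m ∈ Finset.range (2 ^ j), (b 0 - b (2 ^ j)) :=
          Finset.sum_le_sum fun m hm => sub_le_sub_left (hanti (Finset.mem_range.1 hm).le) _
      _ = 2 ^ j * (b 0 - b (2 ^ j)) := by simp [mul_sub]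
      _ ≤ tailU α j x * (K * 2 ^ (α * (j : ℝ))) :=
          mul_le_mul hd hK0 h0 (tailU_pos α j x).le
      _ ≤ 3 * K * 2 ^ (α * (j : ℝ)) * tailU α j x := by
          have : 0 ≤ tailU α j x * (K * 2 ^ (α * (j : ℝ))) :=
            mul_nonneg (tailU_pos α j x).le (h0.trans hK0)
          linarith

end

noncomputable section

lemma Abin_succ (α : ℝ) (j : ℕ) : Abin α (j + 1) = Abin α j * ((α + j + 1) / (j + 1)) := by
  rw [Abin, Finset.prod_range_succ, ← Abin]

lemma Abin_pos {α : ℝ} (hα : 0 < α + 1) (j : ℕ) : 0 < Abin α j :=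
  Finset.prod_pos fun i _ => by
    have : (0 : ℝ) ≤ i := i.cast_nonneg
    exact div_pos (by linarith) (by linarith)

lemma Abin_sub_one_antitone {α : ℝ} (h0 : 0 < α) (h1 : α ≤ 1) : Antitone (Abin (α - 1)) := by
  refine antitone_nat_of_succ_le fun j => ?_
  rw [Abin_succ]
  refine mul_le_of_le_one_right (Abin_pos (by linarith) j).le ?_
  rw [div_le_one (by positivity)]
  linarith

/-- The number `A_{i-1}^α`, with value `0` for `i = 0`. -/
def cesaroWeight (α : ℝ) (i : ℕ) : ℝ := ∑ t ∈ Finset.range i, Abin (α - 1) t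

lemma mul_Abin_sub_one (α : ℝ) (i : ℕ) : (i + 1) * Abin (α - 1) (i + 1) = α * Abin α i := by
  induction i with
  | zero => simp [Abin]
  | succ i ih =>
    rw [Abin_succ (α - 1), Abin_succ α]
    have h1 : (i : ℝ) + 1 ≠ 0 := by positivity
    have h2 : (i : ℝ) + 1 + 1 ≠ 0 := by positivity
    push_cast
    calc ((i : ℝ) + 1 + 1) * (Abin (α - 1) (i + 1) * ((α - 1 + (i + 1) + 1) / (i + 1 + 1)))
        = ((i + 1) * Abin (α - 1) (i + 1)) * ((α + i + 1) / (i + 1)) := by field_simp; ring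
      _ = α * (Abin α i * ((α + i + 1) / (i + 1))) := by rw [ih]; ring

lemma cesaroWeight_succ_eq (α : ℝ) (i : ℕ) : cesaroWeight α (i + 1) = Abin α i := by
  induction i with
  | zero => simp [cesaroWeight, Abin]
  | succ i ih =>
    rw [cesaroWeight, Finset.sum_range_succ, ← cesaroWeight, ih, Abin_succ α]
    have h1 : (i : ℝ) + 1 ≠ 0 := by positivity
    have h := mul_Abin_sub_one α i
    have : Abin (α - 1) (i + 1) = α * Abin α i / (i + 1) := by
      rw [eq_div_iff h1, ← h]; ring
    rw [this]
    field_simp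
    ring

lemma rpow_le_Abin {α : ℝ} (h0 : 0 < α) (h1 : α ≤ 1) (n : ℕ) : ((n : ℝ) + 1) ^ α ≤ Abin α n := by
  induction n with
  | zero => simp [Abin]
  | succ n ih =>
    have hn : (0 : ℝ) < (n : ℝ) + 1 := by positivity
    have hb : (1 + 1 / ((n : ℝ) + 1)) ^ α ≤ 1 + α * (1 / ((n : ℝ) + 1)) :=
      rpow_one_add_le_one_add_mul_self (by linarith [one_div_pos.2 hn]) h0.le h1
    rw [Abin_succ]
    push_cast
    calc ((n : ℝ) + 1 + 1) ^ α = ((n : ℝ) + 1) ^ α * (1 + 1 / ((n : ℝ) + 1)) ^ α := by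
          rw [← Real.mul_rpow hn.le (by positivity)]; congr 1; field_simp
      _ ≤ Abin α n * (1 + α * (1 / ((n : ℝ) + 1))) :=
          mul_le_mul ih hb (by positivity) (Abin_pos (by linarith) n).le
      _ = Abin α n * ((α + n + 1) / (n + 1)) := by field_simp; ring

lemma Abin_le_rpow {α : ℝ} (h0 : 0 < α) (h1 : α ≤ 1) (n : ℕ) :
    Abin α n ≤ 2 * ((n : ℝ) + 1) ^ α := by
  have key : ∀ n : ℕ, Abin α (n + 1) ≤ 2 * ((n : ℝ) + 1) ^ α := by
    intro n
    induction n with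
    | zero => simp [Abin]; linarith
    | succ n ih =>
      have hn : (0 : ℝ) < (n : ℝ) + 1 + 1 := by positivity
      have hn1 : (0 : ℝ) < (n : ℝ) + 1 := by positivity
      have hs : 1 / ((n : ℝ) + 1 + 1) ≤ 1 := by rw [div_le_one hn]; linarith
      have hb : (1 + -(1 / ((n : ℝ) + 1 + 1))) ^ α ≤ 1 + α * -(1 / ((n : ℝ) + 1 + 1)) :=
        rpow_one_add_le_one_add_mul_self (by linarith) h0.le h1
      have hq : (1 + -(1 / ((n : ℝ) + 1 + 1))) = ((n : ℝ) + 1) / ((n : ℝ) + 1 + 1) := by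
        field_simp; ring
      rw [hq, Real.div_rpow hn1.le hn.le, div_le_iff₀ (Real.rpow_pos_of_pos hn α)] at hb
      rw [Abin_succ]
      push_cast
      have hfac : (0 : ℝ) ≤ (α + (n + 1) + 1) / (n + 1 + 1) := by positivity
      have hprod : (1 + α * -(1 / ((n : ℝ) + 1 + 1))) * ((α + (n + 1) + 1) / (n + 1 + 1)) ≤ 1 := by
        have : (1 + α * -(1 / ((n : ℝ) + 1 + 1))) * ((α + (n + 1) + 1) / (n + 1 + 1))
          = 1 - (α / (n + 1 + 1)) ^ 2 := by field_simp; ring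
        rw [this]
        linarith [sq_nonneg (α / ((n : ℝ) + 1 + 1))]
      calc Abin α (n + 1) * ((α + (n + 1) + 1) / (n + 1 + 1))
          ≤ 2 * ((n : ℝ) + 1) ^ α * ((α + (n + 1) + 1) / (n + 1 + 1)) :=
            mul_le_mul_of_nonneg_right ih hfac
        _ ≤ 2 * ((1 + α * -(1 / ((n : ℝ) + 1 + 1))) * ((n : ℝ) + 1 + 1) ^ α)
              * ((α + (n + 1) + 1) / (n + 1 + 1)) := by gcongr
        _ = 2 * ((n : ℝ) + 1 + 1) ^ α * ((1 + α * -(1 / ((n : ℝ) + 1 + 1))) *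
              ((α + (n + 1) + 1) / (n + 1 + 1))) := by ring
        _ ≤ 2 * ((n : ℝ) + 1 + 1) ^ α * 1 := by gcongr
        _ = _ := mul_one _
  refine le_trans ?_ (key n)
  rw [Abin_succ]
  refine le_mul_of_one_le_right (Abin_pos (by linarith) n).le ?_
  rw [le_div_iff₀ (by positivity)]
  linarith

lemma cesaroWeight_zero (α : ℝ) : cesaroWeight α 0 = 0 := by simp [cesaroWeight]

lemma cesaroWeight_mono {α : ℝ} (h0 : 0 < α) : Monotone (cesaroWeight α) :=
  monotone_nat_of_le_succ fun i => by
    rw [cesaroWeight, cesaroWeight, Finset.sum_range_succ]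
    linarith [Abin_pos (α := α - 1) (by linarith) i]

lemma cesaroWeight_nonneg {α : ℝ} (h0 : 0 < α) (i : ℕ) : 0 ≤ cesaroWeight α i :=
  (cesaroWeight_zero α).symm.le.trans (cesaroWeight_mono h0 (Nat.zero_le i))

lemma cesaroWeight_le_rpow {α : ℝ} (h0 : 0 < α) (h1 : α ≤ 1) (r : ℕ) :
    cesaroWeight α r ≤ 2 * (r : ℝ) ^ α := by
  rcases r with _ | r
  · simp [cesaroWeight_zero, Real.zero_rpow h0.ne']
  · rw [cesaroWeight_succ_eq]; push_cast; exact Abin_le_rpow h0 h1 r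

lemma cesaroWeight_add_le {α : ℝ} (h0 : 0 < α) (h1 : α ≤ 1) (a b : ℕ) :
    cesaroWeight α (a + b) ≤ cesaroWeight α a + cesaroWeight α b := by
  rw [cesaroWeight, Finset.sum_range_add]
  exact add_le_add le_rfl (Finset.sum_le_sum fun t _ =>
    Abin_sub_one_antitone h0 h1 (Nat.le_add_left _ _))

lemma cesaroWeight_sub_le {α : ℝ} (h0 : 0 < α) (h1 : α ≤ 1) (M q r : ℕ) :
    cesaroWeight α (M - q) - cesaroWeight α (M - (q + r)) ≤ 2 * (r : ℝ) ^ α := by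
  refine le_trans ?_ (cesaroWeight_le_rpow h0 h1 r)
  have := cesaroWeight_mono h0 (show M - q ≤ M - (q + r) + r by omega)
  linarith [cesaroWeight_add_le h0 h1 (M - (q + r)) r]

lemma risesThenVanishes_cesaroWeight {α : ℝ} (h0 : 0 < α) (h1 : α ≤ 1) (M : ℕ) :
    RisesThenVanishes (fun m => cesaroWeight α (M - m) - cesaroWeight α (M - (m + 1))) M where
  nonneg q := sub_nonneg.2 (cesaroWeight_mono h0 (by omega))
  mono q hq := by
    obtain ⟨t, rfl⟩ : ∃ t, M = q + 2 + t := ⟨M - (q + 2), by omega⟩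
    rw [show q + 2 + t - q = t + 1 + 1 by omega, show q + 2 + t - (q + 1) = t + 1 by omega,
      show q + 2 + t - (q + 1 + 1) = t by omega]
    simp only [cesaroWeight, Finset.sum_range_succ]
    linarith [Abin_sub_one_antitone h0 h1 (Nat.le_succ t)]
  vanish q hq := by rw [show M - q = 0 by omega, show M - (q + 1) = 0 by omega, sub_self]

/-- Concavity of the Cesàro weights. -/
lemma sub_mul_cesaroWeight_sub_le {α : ℝ} (h0 : 0 < α) (h1 : α ≤ 1) {n r : ℕ} (hr : r ≤ n) :
    ((n : ℝ) - r) * (cesaroWeight α n - cesaroWeight α (n - r)) ≤ r * cesaroWeight α n := by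
  obtain ⟨t, rfl⟩ : ∃ t, n = t + r := ⟨n - r, by omega⟩
  rw [Nat.add_sub_cancel]
  have hlow : (t : ℝ) * Abin (α - 1) t ≤ cesaroWeight α t := by
    have := Finset.card_nsmul_le_sum (Finset.range t) (Abin (α - 1)) (Abin (α - 1) t)
      fun i hi => Abin_sub_one_antitone h0 h1 (Finset.mem_range.1 hi).le
    simpa [cesaroWeight] using this
  have hup : cesaroWeight α (t + r) - cesaroWeight α t ≤ r * Abin (α - 1) t := by
    have := Finset.sum_le_card_nsmul (Finset.range r) (fun i => Abin (α - 1) (t + i))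
      (Abin (α - 1) t) fun i _ => Abin_sub_one_antitone h0 h1 (Nat.le_add_right _ _)
    rw [cesaroWeight, Finset.sum_range_add, ← cesaroWeight, add_sub_cancel_left]
    simpa using this
  have hm := cesaroWeight_mono h0 (Nat.le_add_right t r)
  push_cast
  calc ((t : ℝ) + r - r) * (cesaroWeight α (t + r) - cesaroWeight α t)
      ≤ t * (r * Abin (α - 1) t) := by
        rw [add_sub_cancel_right]; exact mul_le_mul_of_nonneg_left hup t.cast_nonneg
    _ = r * (t * Abin (α - 1) t) := by ring
    _ ≤ r * cesaroWeight α (t + r) := by gcongr; exact hlow.trans hm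

lemma sum_Abin_mul_partial_sum (α : ℝ) (n : ℕ) (c : ℕ → ℝ) :
    ∑ k ∈ Finset.range (n + 1), Abin (α - 1) (n - k) * ∑ m ∈ Finset.range k, c m =
      ∑ m ∈ Finset.range n, cesaroWeight α (n - m) * c m := by
  simp_rw [Finset.mul_sum]
  rw [Finset.sum_comm' (t' := Finset.range n) (s' := fun m => Finset.Ico (m + 1) (n + 1))]
  · refine Finset.sum_congr rfl fun m hm => ?_
    have hmn := Finset.mem_range.1 hm
    rw [← Finset.sum_mul, Finset.sum_Ico_eq_sum_range, cesaroWeight,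
      ← Finset.sum_range_reflect, show n + 1 - (m + 1) = n - m by omega]
    congr 1
    refine Finset.sum_congr rfl fun t ht => ?_
    congr 1
    have := Finset.mem_range.1 ht
    omega
  · intro k m
    simp only [Finset.mem_range, Finset.mem_Ico]
    omega

lemma Abin_mul_KK {α : ℝ} (h0 : 0 < α) (n : ℕ) (x : WG) :
    Abin α n * KK α n x = ∑ m ∈ Finset.range n, cesaroWeight α (n - m) * kacz m x := by
  rw [KK, ← mul_assoc, mul_inv_cancel₀ (Abin_pos (by linarith) n).ne', one_mul]
  exact sum_Abin_mul_partial_sum α n fun m => kacz m x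

lemma Abin_mul_KK_eq_sum_charSum {α : ℝ} (h0 : 0 < α) (n : ℕ) (x : WG) :
    Abin α n * KK α n x = cesaroWeight α n + ∑ j ∈ Finset.range (Nat.log 2 n + 1),
      rad j x * charSum j (fun m => cesaroWeight α (n - 2 ^ j - m)) x := by
  have h := sum_range_two_pow_kacz (fun m => cesaroWeight α (n - m)) x (Nat.log 2 n + 1)
  simp only [← Nat.sub_sub, Nat.sub_zero] at h ⊢
  rw [← h, Abin_mul_KK h0]
  refine Finset.sum_subset
    (Finset.range_mono (Nat.lt_pow_succ_log_self one_lt_two n).le) fun m _ hm => ?_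
  rw [Finset.mem_range, not_lt] at hm
  rw [Nat.sub_eq_zero_of_le hm, cesaroWeight_zero, zero_mul]

lemma abs_dirPow_sum_le {α : ℝ} (h0 : 0 < α) (h1 : α ≤ 1) {n : ℕ} (hn : n ≠ 0) (x : WG) :
    |cesaroWeight α n + ∑ j ∈ Finset.range (Nat.log 2 n + 1),
      rad j x * (cesaroWeight α (n - 2 ^ j) * dirPow j x)| ≤
    2 * cesaroWeight α n * ∑ j ∈ Finset.range (Nat.log 2 n + 1),
      (2 : ℝ) ^ (α * ((j : ℝ) - Nat.log 2 n)) * tailU α j x := by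
  set A := Nat.log 2 n with hA
  set B := cesaroWeight α with hB
  have hAn : 2 ^ A ≤ n := Nat.pow_log_le_self 2 hn
  have hBn : 0 ≤ B n := cesaroWeight_nonneg h0 n
  let β : ℕ → ℝ := fun j => if j = 0 then B n else B (n - 2 ^ (j - 1))
  have hβle : ∀ j, β j ≤ B n := fun j => by
    by_cases hj : j = 0
    · simp [β, hj]
    · simp only [β, if_neg hj]; exact cesaroWeight_mono h0 (Nat.sub_le _ _)
  have hβanti : ∀ j, β (j + 1) ≤ β j := fun j => by
    by_cases hj : j = 0
    · simp only [β, hj]; exact cesaroWeight_mono h0 (Nat.sub_le _ _)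
    · simp only [β, if_neg hj, if_neg (Nat.succ_ne_zero j)]
      exact cesaroWeight_mono h0 (Nat.sub_le_sub_left (Nat.pow_le_pow_right two_pos (by omega)) _)
  have habel : ∀ J, B n + ∑ j ∈ Finset.range J, rad j x * (B (n - 2 ^ j) * dirPow j x) =
      β J * dirPow J x + ∑ j ∈ Finset.range J, (β j - β (j + 1)) * dirPow j x := by
    intro J
    induction J with
    | zero => simp [β, dirPow]
    | succ J ih =>
      rw [Finset.sum_range_succ, Finset.sum_range_succ, ← add_assoc, ih]
      have hb : B (n - 2 ^ J) = β (J + 1) := by simp [β]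
      rw [hb, mul_left_comm, rad_mul_dirPow]
      ring
  have hterm : ∀ j ∈ Finset.range A, (β j - β (j + 1)) * dirPow j x ≤
      2 * B n * ((2 : ℝ) ^ (α * ((j : ℝ) - A)) * tailU α j x) := by
    intro j hj
    have hjA := Finset.mem_range.1 hj
    have hpow : 2 * 2 ^ j ≤ 2 ^ A := by
      rw [← pow_succ']; exact Nat.pow_le_pow_right two_pos hjA
    have hconc := sub_mul_cesaroWeight_sub_le h0 h1 (n := n) (r := 2 ^ j) (by omega)
    have hhalf : (2 : ℝ) ^ A / 2 ≤ (n : ℝ) - (2 ^ j : ℕ) := by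
      have e1 : (2 : ℝ) ^ A ≤ n := by exact_mod_cast hAn
      have e2 : 2 * (2 : ℝ) ^ j ≤ 2 ^ A := by exact_mod_cast hpow
      push_cast; linarith
    have hdiff : 0 ≤ B n - B (n - 2 ^ j) := sub_nonneg.2 (cesaroWeight_mono h0 (Nat.sub_le _ _))
    have h2 : (2 : ℝ) ^ A / 2 * (B n - B (n - 2 ^ j)) ≤ 2 ^ j * B n := by
      refine (mul_le_mul_of_nonneg_right hhalf hdiff).trans ?_
      simpa using hconc
    have h3 : B n - B (n - 2 ^ j) ≤ 2 * B n * (2 : ℝ) ^ (α * ((j : ℝ) - A)) := by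
      have e1 : (2 : ℝ) ^ ((j : ℝ) - A) ≤ (2 : ℝ) ^ (α * ((j : ℝ) - A)) := by
        refine Real.rpow_le_rpow_of_exponent_le one_le_two ?_
        have : (j : ℝ) < A := by exact_mod_cast hjA
        nlinarith
      have e2 : (2 : ℝ) ^ ((j : ℝ) - A) = 2 ^ j / 2 ^ A := by
        rw [Real.rpow_sub two_pos, Real.rpow_natCast, Real.rpow_natCast]
      refine le_trans ?_ (mul_le_mul_of_nonneg_left e1 (by positivity))
      rw [e2, mul_div_assoc', le_div_iff₀ (by positivity)]
      linarith
    have h4 : β j - β (j + 1) ≤ 2 * B n * (2 : ℝ) ^ (α * ((j : ℝ) - A)) := by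
      refine le_trans ?_ h3
      have hb : β (j + 1) = B (n - 2 ^ j) := by simp [β]
      rw [hb]
      linarith [hβle j]
    rw [← mul_assoc]
    exact mul_le_mul h4 (dirPow_le_tailU α j x) (dirPow_nonneg j x) (by positivity)
  rw [Finset.sum_range_succ, ← add_assoc, habel, Finset.sum_range_succ, mul_add, Finset.mul_sum]
  refine (abs_add_le _ _).trans ?_
  have hlast : |rad A x * (B (n - 2 ^ A) * dirPow A x)| ≤ B n * tailU α A x := by
    rw [abs_mul, abs_rad, one_mul, abs_of_nonneg
      (mul_nonneg (cesaroWeight_nonneg h0 _) (dirPow_nonneg _ _))]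
    exact mul_le_mul (cesaroWeight_mono h0 (Nat.sub_le _ _)) (dirPow_le_tailU α A x)
      (dirPow_nonneg A x) hBn
  have hmain : β A * dirPow A x ≤ B n * tailU α A x :=
    mul_le_mul (hβle A) (dirPow_le_tailU α A x) (dirPow_nonneg A x) hBn
  have hβnn : 0 ≤ β A := by
    by_cases hj : A = 0
    · simp [β, hj, hBn]
    · simp only [β, if_neg hj]; exact cesaroWeight_nonneg h0 _
  rw [abs_of_nonneg (add_nonneg (mul_nonneg hβnn (dirPow_nonneg A x))
    (Finset.sum_nonneg fun j _ => mul_nonneg (sub_nonneg.2 (hβanti j)) (dirPow_nonneg j x)))]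
  have := Finset.sum_le_sum hterm
  rw [sub_self, mul_zero, Real.rpow_zero, one_mul]
  linarith

/-- Pointwise bound of the one-dimensional Walsh–Kaczmarz Cesàro kernel. -/
lemma abs_KK_le {α : ℝ} (h0 : 0 < α) (h1 : α ≤ 1) {n : ℕ} (hn : n ≠ 0) (x : WG) :
    |KK α n x| ≤ 8 * ∑ j ∈ Finset.range (Nat.log 2 n + 1),
      (2 : ℝ) ^ (α * ((j : ℝ) - Nat.log 2 n)) * tailU α j x := by
  have hApos := Abin_pos (α := α) (by linarith) n
  refine le_of_mul_le_mul_left ?_ hApos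
  rw [← abs_of_pos hApos, ← abs_mul, abs_of_pos hApos, Abin_mul_KK_eq_sum_charSum h0]
  set A := Nat.log 2 n with hA
  set Tsum := ∑ j ∈ Finset.range (A + 1), (2 : ℝ) ^ (α * ((j : ℝ) - A)) * tailU α j x with hT
  have hT0 : 0 ≤ Tsum := Finset.sum_nonneg fun j _ =>
    mul_nonneg (by positivity) (tailU_pos α j x).le
  have hB : cesaroWeight α n ≤ Abin α n := by
    rw [← cesaroWeight_succ_eq]; exact cesaroWeight_mono h0 (Nat.le_succ n)
  have hAA : (2 : ℝ) ^ (α * (A : ℝ)) ≤ Abin α n := by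
    refine le_trans ?_ (rpow_le_Abin h0 h1 n)
    rw [mul_comm, Real.rpow_mul two_pos.le, Real.rpow_natCast]
    refine Real.rpow_le_rpow (by positivity) ?_ h0.le
    have : (2 : ℝ) ^ A ≤ n := by exact_mod_cast Nat.pow_log_le_self 2 hn
    linarith
  have hdev : ∀ j ∈ Finset.range (A + 1),
      |rad j x * (charSum j (fun m => cesaroWeight α (n - 2 ^ j - m)) x -
        cesaroWeight α (n - 2 ^ j) * dirPow j x)| ≤
      6 * Abin α n * ((2 : ℝ) ^ (α * ((j : ℝ) - A)) * tailU α j x) := by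
    intro j _
    rw [abs_mul, abs_rad, one_mul]
    have := abs_charSum_sub_le (α := α) j (b := fun m => cesaroWeight α (n - 2 ^ j - m))
      (risesThenVanishes_cesaroWeight h0 h1 _) (K := 2) (cesaroWeight_sub_le h0 h1 _) x
    rw [Nat.sub_zero] at this
    refine this.trans ?_
    have e : (2 : ℝ) ^ (α * (j : ℝ)) = 2 ^ (α * (A : ℝ)) * 2 ^ (α * ((j : ℝ) - A)) := by
      rw [← Real.rpow_add two_pos]; ring_nf
    rw [e]
    have hU := (tailU_pos α j x).le
    calc 3 * 2 * ((2 : ℝ) ^ (α * (A : ℝ)) * 2 ^ (α * ((j : ℝ) - A))) * tailU α j x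
        = 6 * (2 : ℝ) ^ (α * (A : ℝ)) * (2 ^ (α * ((j : ℝ) - A)) * tailU α j x) := by ring
      _ ≤ _ := by gcongr
  have hsplit : cesaroWeight α n + ∑ j ∈ Finset.range (A + 1),
      rad j x * charSum j (fun m => cesaroWeight α (n - 2 ^ j - m)) x =
      (cesaroWeight α n + ∑ j ∈ Finset.range (A + 1),
        rad j x * (cesaroWeight α (n - 2 ^ j) * dirPow j x)) +
      ∑ j ∈ Finset.range (A + 1),
        rad j x * (charSum j (fun m => cesaroWeight α (n - 2 ^ j - m)) x -
        cesaroWeight α (n - 2 ^ j) * dirPow j x) := by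
    rw [add_assoc, ← Finset.sum_add_distrib]
    congr 1
    exact Finset.sum_congr rfl fun j _ => by ring
  rw [hsplit]
  refine (abs_add_le _ _).trans ?_
  have e1 := abs_dirPow_sum_le h0 h1 hn x
  have e2 := (Finset.abs_sum_le_sum_abs _ _).trans (Finset.sum_le_sum hdev)
  rw [← Finset.mul_sum, ← hT] at e2
  rw [← hA, ← hT] at e1
  have e3 : 2 * cesaroWeight α n * Tsum ≤ 2 * Abin α n * Tsum := by gcongr
  linarith

end

noncomputable section

instance : IsProbabilityMeasure μW := by
  constructor
  rw [← TopologicalSpace.PositiveCompacts.coe_top (α := WG)]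
  exact Measure.addHaarMeasure_self

instance : μW.IsAddHaarMeasure := by unfold μW; infer_instance

/-- The element of the Walsh group with the single nonzero coordinate `j`. -/
def unitW (j : ℕ) : WG := Pi.single j 1

/-- The dyadic interval `I_N(y)`. -/
def cyl (N : ℕ) (y : WG) : Set WG := {t | ∀ i < N, t i = y i}

lemma measurableSet_cyl (N : ℕ) (y : WG) : MeasurableSet (cyl N y) := by
  have : cyl N y = ⋂ i, ⋂ (_ : i < N), (fun t : WG => t i) ⁻¹' {y i} := by
    ext t; simp [cyl]
  rw [this]
  exact MeasurableSet.iInter fun i => MeasurableSet.iInter fun _ =>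
    measurable_pi_apply i (measurableSet_singleton _)

lemma unitW_apply_self (j : ℕ) : unitW j j = 1 := by simp [unitW]

lemma add_unitW_apply_of_ne {i j : ℕ} (h : i ≠ j) (x : WG) : (x + unitW j) i = x i := by
  simp [unitW, h]

lemma add_unitW_apply_eq_zero_iff (j : ℕ) (x : WG) : (x + unitW j) j = 0 ↔ x j ≠ 0 := by
  rw [Pi.add_apply, unitW_apply_self]
  generalize x j = a
  revert a; decide

lemma add_unitW_add_unitW (j : ℕ) (x : WG) : x + unitW j + unitW j = x := by
  ext i
  simp only [Pi.add_apply]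
  generalize x i = a; generalize unitW j i = b
  revert a b; decide

lemma add_unitW_mem_cyl {N j : ℕ} (h : N ≤ j) {y t : WG} : t + unitW j ∈ cyl N y ↔ t ∈ cyl N y := by
  refine forall_congr' fun i => imp_congr_right fun hi => ?_
  rw [add_unitW_apply_of_ne (by omega)]

lemma setLIntegral_add_self_eq {s : Set WG} (hs : MeasurableSet s) {e : WG}
    (hse : ∀ t, t + e ∈ s ↔ t ∈ s) {φ : WG → ℝ≥0∞} (hφ : Measurable φ) :
    ∫⁻ t in s, φ t ∂μW + ∫⁻ t in s, φ t ∂μW = ∫⁻ t in s, (φ t + φ (t + e)) ∂μW := by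
  rw [lintegral_add_left hφ]
  congr 1
  rw [← lintegral_indicator hs, ← lintegral_indicator hs,
    ← lintegral_add_right_eq_self (s.indicator φ) e]
  refine lintegral_congr fun t => ?_
  by_cases ht : t ∈ s
  · rw [Set.indicator_of_mem ht, Set.indicator_of_mem ((hse t).2 ht)]
  · rw [Set.indicator_of_notMem ht, Set.indicator_of_notMem (mt (hse t).1 ht)]

lemma setLIntegral_le_of_add_le {s : Set WG} (hs : MeasurableSet s) {e : WG}
    (hse : ∀ t, t + e ∈ s ↔ t ∈ s) {φ ψ : WG → ℝ≥0∞} (hφ : Measurable φ) (hψ : Measurable ψ)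
    (h : ∀ t, φ t + φ (t + e) ≤ 2 * ψ t) :
    ∫⁻ t in s, φ t ∂μW ≤ ∫⁻ t in s, ψ t ∂μW := by
  have h2 : 2 * ∫⁻ t in s, φ t ∂μW ≤ 2 * ∫⁻ t in s, ψ t ∂μW := by
    rw [two_mul, setLIntegral_add_self_eq hs hse hφ, ← lintegral_const_mul _ hψ]
    exact lintegral_mono h
  exact (ENNReal.mul_le_mul_iff_right two_ne_zero ENNReal.ofNat_ne_top).1 h2

lemma μW_cyl (N : ℕ) (y : WG) : μW (cyl N y) = (2⁻¹ : ℝ≥0∞) ^ N := by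
  induction N with
  | zero => simp [cyl]
  | succ N ih =>
    have h := setLIntegral_add_self_eq (measurableSet_cyl N y) (e := unitW N)
      (fun t => add_unitW_mem_cyl le_rfl)
      (φ := (cyl (N + 1) y).indicator 1) (measurable_one.indicator (measurableSet_cyl _ _))
    have h1 : ∫⁻ t in cyl N y, (cyl (N + 1) y).indicator 1 t ∂μW = μW (cyl (N + 1) y) := by
      rw [lintegral_indicator_one (measurableSet_cyl _ _),
        Measure.restrict_apply (measurableSet_cyl _ _), Set.inter_eq_left.2]
      exact fun t ht i hi => ht i (by omega)
    have h2 : ∫⁻ t in cyl N y, ((cyl (N + 1) y).indicator 1 t +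
        (cyl (N + 1) y).indicator 1 (t + unitW N)) ∂μW = μW (cyl N y) := by
      rw [setLIntegral_congr_fun (g := fun _ => 1) (measurableSet_cyl N y), setLIntegral_one]
      intro t ht
      have hmem : ∀ u ∈ cyl N y, (u ∈ cyl (N + 1) y ↔ u N = y N) := by
        intro u hu
        refine ⟨fun h => h N (Nat.lt_succ_self N), fun h i hi => ?_⟩
        rcases Nat.lt_succ_iff_lt_or_eq.1 hi with hi | rfl
        exacts [hu i hi, h]
      have e1 := hmem t ht
      have e2 := hmem (t + unitW N) ((add_unitW_mem_cyl le_rfl).2 ht)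
      have e3 : (t + unitW N) N = y N ↔ t N ≠ y N := by
        rw [Pi.add_apply, unitW_apply_self]
        generalize t N = a; generalize y N = b
        revert a b; decide
      by_cases hy : t N = y N
      · simp [Set.indicator, e1, e2.trans e3, hy]
      · simp [Set.indicator, e1, e2.trans e3, hy]
    rw [h1, h2, ih, ← two_mul] at h
    rw [pow_succ, ← h, mul_comm, ← mul_assoc, ENNReal.inv_mul_cancel two_ne_zero
      ENNReal.ofNat_ne_top, one_mul]

lemma μW_cyl_ofReal (N : ℕ) (y : WG) : μW (cyl N y) = ENNReal.ofReal ((2 : ℝ) ^ (-(N : ℝ))) := by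
  rw [μW_cyl, Real.rpow_neg two_pos.le, Real.rpow_natCast, ← inv_pow,
    ENNReal.ofReal_pow (by positivity), ENNReal.ofReal_inv_of_pos two_pos, ENNReal.ofReal_ofNat]

lemma tailW_congr (α : ℝ) {j : ℕ} {x y : WG} (h : ∀ i < j, x i = y i) :
    tailW α j x = tailW α j y := by
  induction j with
  | zero => rfl
  | succ j ih => rw [tailW, tailW, ih fun i hi => h i (by omega), h j (Nat.lt_succ_self j)]

lemma tailU_congr (α : ℝ) {j : ℕ} {x y : WG} (h : ∀ i < j, x i = y i) :
    tailU α j x = tailU α j y := by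
  induction j with
  | zero => rfl
  | succ j ih =>
    rw [tailU, tailU, ih fun i hi => h i (by omega), h j (Nat.lt_succ_self j),
      tailW_congr α fun i hi => h i (by omega)]

lemma measurableSet_coord_eq_zero (j : ℕ) : MeasurableSet {x : WG | x j = 0} :=
  (measurable_pi_apply (X := fun _ => ZMod 2) j) (measurableSet_singleton 0)

lemma measurable_tailW (α : ℝ) (j : ℕ) : Measurable (tailW α j) := by
  induction j with
  | zero => exact measurable_const
  | succ j ih => exact ih.ite (measurableSet_coord_eq_zero j) measurable_const

lemma measurable_tailU (α : ℝ) (j : ℕ) : Measurable (tailU α j) := by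
  induction j with
  | zero => exact measurable_const
  | succ j ih =>
    exact (ih.const_mul 2).ite (measurableSet_coord_eq_zero j) (measurable_tailW α j)

/-- A combination of `p`-th powers of `tailU` and `tailW` whose averages over the coordinate `j`
are controlled, see `tailLyapunov_add_le`. -/
def tailLyapunov (α p a b : ℝ) (j : ℕ) (x : WG) : ℝ :=
  tailU α j x ^ p + a * tailW α j x ^ p + b * 2 ^ (-(α * p * j))

lemma tailLyapunov_add_le {α p a b : ℝ} (ha : 1 + a ≤ 2 ^ p * a)
    (hb : (a + 2 * b) * 2 ^ (-(α * p)) ≤ 2 ^ p * b) (j : ℕ) (x : WG) :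
    tailLyapunov α p a b (j + 1) x + tailLyapunov α p a b (j + 1) (x + unitW j) ≤
      2 ^ p * tailLyapunov α p a b j x := by
  wlog hx : x j = 0 generalizing x
  · have := this (x + unitW j) ((add_unitW_apply_eq_zero_iff j x).2 hx)
    rw [add_unitW_add_unitW, add_comm] at this
    refine this.trans_eq ?_
    have hc : ∀ i < j, (x + unitW j) i = x i := fun i hi => add_unitW_apply_of_ne hi.ne x
    rw [tailLyapunov, tailLyapunov, tailU_congr α hc, tailW_congr α hc]
  have hc : ∀ i < j, (x + unitW j) i = x i := fun i hi => add_unitW_apply_of_ne hi.ne x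
  have hx' : (x + unitW j) j ≠ 0 := fun h => (add_unitW_apply_eq_zero_iff j x).1 h hx
  have hU := tailU_pos α j x
  have hW := tailW_pos α j x
  simp only [tailLyapunov, tailU, tailW, if_pos hx, if_neg hx', tailW_congr α hc]
  have e1 : (2 * tailU α j x) ^ p = 2 ^ p * tailU α j x ^ p :=
    Real.mul_rpow two_pos.le hU.le
  have e2 : ((2 : ℝ) ^ (-(α * ((j : ℝ) + 1)))) ^ p = 2 ^ (-(α * p)) * 2 ^ (-(α * p * j)) := by
    rw [← Real.rpow_mul two_pos.le, ← Real.rpow_add two_pos]; ring_nf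
  have e3 : (2 : ℝ) ^ (-(α * p * ((j + 1 : ℕ) : ℝ))) = 2 ^ (-(α * p)) * 2 ^ (-(α * p * j)) := by
    rw [← Real.rpow_add two_pos]; push_cast; ring_nf
  rw [e1, e2, e3]
  have h1 := mul_le_mul_of_nonneg_right ha (Real.rpow_pos_of_pos hW p).le
  have h2 := mul_le_mul_of_nonneg_right hb
    (Real.rpow_pos_of_pos two_pos (-(α * p * (j : ℝ)))).le
  linarith

lemma measurable_tailLyapunov (α p a b : ℝ) (j : ℕ) : Measurable (tailLyapunov α p a b j) :=
  (((measurable_tailU α j).pow_const p).add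
    (((measurable_tailW α j).pow_const p).const_mul a)).add_const _

lemma tailLyapunov_nonneg {α p a b : ℝ} (ha : 0 ≤ a) (hb : 0 ≤ b) (j : ℕ) (x : WG) :
    0 ≤ tailLyapunov α p a b j x := by
  have hU := tailU_pos α j x
  have hW := tailW_pos α j x
  unfold tailLyapunov
  positivity

lemma setLIntegral_tailLyapunov_le {α p a b : ℝ} (ha0 : 0 ≤ a) (hb0 : 0 ≤ b)
    (ha : 1 + a ≤ 2 ^ p * a) (hb : (a + 2 * b) * 2 ^ (-(α * p)) ≤ 2 ^ p * b) (N i : ℕ) (y : WG) :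
    ∫⁻ t in cyl N y, ENNReal.ofReal (tailLyapunov α p a b (N + i) t) ∂μW ≤
      ENNReal.ofReal (2 ^ ((p - 1) * i) * 2 ^ (-(N : ℝ)) * tailLyapunov α p a b N y) := by
  induction i with
  | zero =>
    rw [setLIntegral_congr_fun
      (g := fun _ => ENNReal.ofReal (tailLyapunov α p a b N y)) (measurableSet_cyl N y)]
    · rw [setLIntegral_const, μW_cyl_ofReal, ← ENNReal.ofReal_mul (tailLyapunov_nonneg ha0 hb0 N y)]
      simp [mul_comm]
    · intro t ht
      simp only [add_zero, tailLyapunov, tailU_congr α ht, tailW_congr α ht]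
  | succ i ih =>
    have hm := (measurable_tailLyapunov α p a b (N + (i + 1))).ennreal_ofReal
    have hm' := (measurable_tailLyapunov α p a b (N + i)).ennreal_ofReal
    refine (setLIntegral_le_of_add_le (measurableSet_cyl N y) (e := unitW (N + i))
      (fun t => add_unitW_mem_cyl (Nat.le_add_right _ _)) hm
      (ψ := fun t => ENNReal.ofReal (2 ^ (p - 1)) * ENNReal.ofReal (tailLyapunov α p a b (N + i) t))
      (hm'.const_mul _) fun t => ?_).trans ?_
    · rw [← ENNReal.ofReal_add (tailLyapunov_nonneg ha0 hb0 _ _) (tailLyapunov_nonneg ha0 hb0 _ _),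
        ← ENNReal.ofReal_mul (by positivity), ← ENNReal.ofReal_ofNat 2,
        ← ENNReal.ofReal_mul (by positivity), ← mul_assoc]
      refine ENNReal.ofReal_le_ofReal ((tailLyapunov_add_le ha hb (N + i) t).trans_eq ?_)
      rw [Real.rpow_sub_one two_ne_zero]
      ring
    · rw [lintegral_const_mul _ hm']
      refine (mul_le_mul_right ih _).trans_eq ?_
      rw [← ENNReal.ofReal_mul (by positivity), ← mul_assoc, ← mul_assoc,
        ← Real.rpow_add two_pos]
      push_cast
      ring_nf

/-- Conditional moments of `tailU`. -/
lemma exists_setLIntegral_tailU_le {α p : ℝ} (hα : 0 < α) (hp : 0 < p) (hαp : 1 < α * p + p) :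
    ∃ C : ℝ, 0 ≤ C ∧ ∀ (N i : ℕ) (y : WG),
      ∫⁻ t in cyl N y, ENNReal.ofReal (tailU α (N + i) t ^ p) ∂μW ≤
        ENNReal.ofReal (C * 2 ^ ((p - 1) * i) * 2 ^ (-(N : ℝ)) * tailU α N y ^ p) := by
  have h2p : (1 : ℝ) < 2 ^ p := Real.one_lt_rpow one_lt_two hp
  have hd : 0 < (2 : ℝ) ^ p - 2 * 2 ^ (-(α * p)) := by
    have : (2 : ℝ) * 2 ^ (-(α * p)) = 2 ^ (1 + -(α * p)) := by
      rw [Real.rpow_add two_pos, Real.rpow_one]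
    rw [this, sub_pos]
    exact Real.rpow_lt_rpow_of_exponent_lt one_lt_two (by linarith)
  obtain ⟨a, ha0, ha⟩ : ∃ a : ℝ, 0 ≤ a ∧ 1 + a ≤ 2 ^ p * a := by
    refine ⟨1 / (2 ^ p - 1), by apply div_nonneg <;> linarith, le_of_eq ?_⟩
    have : (2 : ℝ) ^ p - 1 ≠ 0 := by linarith
    field_simp
    ring
  obtain ⟨b, hb0, hb⟩ : ∃ b : ℝ, 0 ≤ b ∧ (a + 2 * b) * 2 ^ (-(α * p)) ≤ 2 ^ p * b := by
    refine ⟨a * 2 ^ (-(α * p)) / (2 ^ p - 2 * 2 ^ (-(α * p))), by positivity, le_of_eq ?_⟩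
    generalize (2 : ℝ) ^ (-(α * p)) = r at hd ⊢
    generalize (2 : ℝ) ^ p = s at hd ⊢
    have := hd.ne'
    field_simp
    ring
  refine ⟨1 + a + b, by positivity, fun N i y => ?_⟩
  refine le_trans (lintegral_mono fun t => ENNReal.ofReal_le_ofReal ?_)
    ((setLIntegral_tailLyapunov_le ha0 hb0 ha hb N i y).trans (ENNReal.ofReal_le_ofReal ?_))
  · have hW := tailW_pos α (N + i) t
    have h1 : 0 ≤ a * tailW α (N + i) t ^ p := by positivity
    have h2 : 0 ≤ b * (2 : ℝ) ^ (-(α * p * ((N + i : ℕ) : ℝ))) := by positivity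
    rw [tailLyapunov]; linarith
  · have hW := tailW_pos α N y
    have e1 : tailW α N y ^ p ≤ tailU α N y ^ p :=
      Real.rpow_le_rpow hW.le (tailW_le_tailU hα.le N y) hp.le
    have e2 : (2 : ℝ) ^ (-(α * p * N)) ≤ tailU α N y ^ p := by
      rw [show -(α * p * (N : ℝ)) = -(α * N) * p by ring, Real.rpow_mul two_pos.le]
      exact Real.rpow_le_rpow (by positivity)
        ((rpow_le_tailW hα.le N y).trans (tailW_le_tailU hα.le N y)) hp.le
    have e3 : tailLyapunov α p a b N y ≤ (1 + a + b) * tailU α N y ^ p := by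
      rw [tailLyapunov]; nlinarith
    calc _ ≤ (2 : ℝ) ^ ((p - 1) * i) * 2 ^ (-(N : ℝ)) * ((1 + a + b) * tailU α N y ^ p) := by gcongr
      _ = _ := by ring

lemma exists_sum_rpow_le {δ : ℝ} (hδ : 0 < δ) : ∃ C : ℝ, 0 ≤ C ∧ ∀ N : ℕ,
    ∑ j ∈ Finset.range (N + 1), (2 : ℝ) ^ (δ * ((j : ℝ) - N)) ≤ C := by
  have h1 : (2 : ℝ) ^ (-δ) < 1 := Real.rpow_lt_one_of_one_lt_of_neg one_lt_two (by linarith)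
  refine ⟨(1 - 2 ^ (-δ))⁻¹, inv_nonneg.2 (by linarith), fun N => ?_⟩
  induction N with
  | zero =>
    simp only [zero_add, Finset.sum_range_one, sub_self, mul_zero, Real.rpow_zero]
    refine (one_le_inv₀ (by linarith)).2 ?_
    have : (0 : ℝ) < 2 ^ (-δ) := by positivity
    linarith
  | succ N ih =>
    rw [Finset.sum_range_succ, sub_self, mul_zero, Real.rpow_zero]
    have : ∀ j ∈ Finset.range (N + 1), (2 : ℝ) ^ (δ * ((j : ℝ) - (N + 1 : ℕ))) =
        2 ^ (-δ) * 2 ^ (δ * ((j : ℝ) - N)) := fun j _ => by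
      rw [← Real.rpow_add two_pos]; push_cast; ring_nf
    rw [Finset.sum_congr rfl this, ← Finset.mul_sum]
    calc _ ≤ (2 : ℝ) ^ (-δ) * (1 - 2 ^ (-δ))⁻¹ + 1 := by gcongr
      _ = (1 - 2 ^ (-δ))⁻¹ := by
        have : (1 : ℝ) - 2 ^ (-δ) ≠ 0 := by linarith
        field_simp
        ring

/-- The majorant of the averages of the Cesàro kernels over dyadic intervals of length `2^{-N}`. -/
def kernelMajorant (α : ℝ) (N : ℕ) (z : WG) : ℝ :=
  2 ^ (-(N : ℝ)) * ∑ j ∈ Finset.range (N + 1), (2 : ℝ) ^ (α * ((j : ℝ) - N)) * tailU α j z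

lemma measurable_kernelMajorant (α : ℝ) (N : ℕ) : Measurable (kernelMajorant α N) :=
  (Finset.measurable_fun_sum _ fun j _ => (measurable_tailU α j).const_mul _).const_mul _

lemma exists_setLIntegral_KK_le {α : ℝ} (h0 : 0 < α) (h1 : α ≤ 1) :
    ∃ C : ℝ, 0 ≤ C ∧ ∀ (n N : ℕ) (z : WG), n ≠ 0 → N ≤ Nat.log 2 n →
      ∫⁻ t in cyl N z, ENNReal.ofReal |KK α n t| ∂μW ≤
        ENNReal.ofReal (C * kernelMajorant α N z) := by
  obtain ⟨C, hC0, hC⟩ := exists_setLIntegral_tailU_le (p := 1) h0 one_pos (by linarith)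
  obtain ⟨G, hG0, hG⟩ := exists_sum_rpow_le h0
  refine ⟨8 * (1 + G * C), by positivity, fun n N z hn hN => ?_⟩
  set A := Nat.log 2 n with hA
  have hcyl : ∀ j, ∫⁻ t in cyl N z, ENNReal.ofReal (tailU α j t) ∂μW ≤
      ENNReal.ofReal (2 ^ (-(N : ℝ)) * ((if j < N then tailU α j z else 0) + C * tailU α N z)) := by
    intro j
    have hUN := (tailU_pos α N z).le
    by_cases hj : j < N
    · rw [setLIntegral_congr_fun (g := fun _ => ENNReal.ofReal (tailU α j z))
        (measurableSet_cyl N z) fun t ht => by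
          simp only [tailU_congr α fun i (hi : i < j) => ht i (hi.trans hj)],
        setLIntegral_const, μW_cyl_ofReal, ← ENNReal.ofReal_mul (tailU_pos α j z).le, if_pos hj]
      refine ENNReal.ofReal_le_ofReal ?_
      rw [mul_comm]
      gcongr
      have : 0 ≤ C * tailU α N z := by positivity
      linarith
    · obtain ⟨i, rfl⟩ := Nat.exists_eq_add_of_le (not_lt.1 hj)
      rw [if_neg hj, zero_add]
      have := hC N i z
      simp only [Real.rpow_one, sub_self, zero_mul, Real.rpow_zero, mul_one] at this
      refine this.trans_eq ?_
      ring_nf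
  have hcoef : ∀ j : ℕ, (0 : ℝ) ≤ 2 ^ (α * ((j : ℝ) - A)) := fun j => by positivity
  calc ∫⁻ t in cyl N z, ENNReal.ofReal |KK α n t| ∂μW
      ≤ ∫⁻ t in cyl N z, ENNReal.ofReal 8 * ∑ j ∈ Finset.range (A + 1),
          ENNReal.ofReal (2 ^ (α * ((j : ℝ) - A))) * ENNReal.ofReal (tailU α j t) ∂μW := by
        refine lintegral_mono fun t => (ENNReal.ofReal_le_ofReal (abs_KK_le h0 h1 hn t)).trans_eq ?_
        rw [← hA, ENNReal.ofReal_mul (by norm_num), ENNReal.ofReal_sum_of_nonneg fun j _ =>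
          mul_nonneg (hcoef j) (tailU_pos α j t).le]
        simp only [ENNReal.ofReal_mul (hcoef _)]
    _ = ENNReal.ofReal 8 * ∑ j ∈ Finset.range (A + 1), ENNReal.ofReal (2 ^ (α * ((j : ℝ) - A))) *
          ∫⁻ t in cyl N z, ENNReal.ofReal (tailU α j t) ∂μW := by
        rw [lintegral_const_mul, lintegral_finsetSum]
        · simp only [lintegral_const_mul _ (measurable_tailU α _).ennreal_ofReal]
        · exact fun j _ => (measurable_tailU α j).ennreal_ofReal.const_mul _
        · exact Finset.measurable_fun_sum _ fun j _ =>
            (measurable_tailU α j).ennreal_ofReal.const_mul _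
    _ ≤ ENNReal.ofReal 8 * ∑ j ∈ Finset.range (A + 1), ENNReal.ofReal (2 ^ (α * ((j : ℝ) - A))) *
          ENNReal.ofReal (2 ^ (-(N : ℝ)) *
            ((if j < N then tailU α j z else 0) + C * tailU α N z)) := by
        gcongr with j
        exact hcyl j
    _ = ENNReal.ofReal (8 * ∑ j ∈ Finset.range (A + 1), 2 ^ (α * ((j : ℝ) - A)) *
          (2 ^ (-(N : ℝ)) * ((if j < N then tailU α j z else 0) + C * tailU α N z))) := by
        have hnn : ∀ j : ℕ, 0 ≤ (2 : ℝ) ^ (-(N : ℝ)) *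
            ((if j < N then tailU α j z else 0) + C * tailU α N z) := fun j => by
          have := (tailU_pos α N z).le
          have := (tailU_pos α j z).le
          split_ifs <;> positivity
        rw [ENNReal.ofReal_mul (by norm_num), ENNReal.ofReal_sum_of_nonneg fun j _ =>
          mul_nonneg (hcoef j) (hnn j)]
        simp only [ENNReal.ofReal_mul (hcoef _)]
    _ ≤ _ := by
        refine ENNReal.ofReal_le_ofReal ?_
        rw [mul_assoc 8]
        refine mul_le_mul_of_nonneg_left ?_ (by norm_num)
        set S := ∑ j ∈ Finset.range (N + 1), (2 : ℝ) ^ (α * ((j : ℝ) - N)) * tailU α j z with hS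
        have hSnn : ∀ j ∈ Finset.range (N + 1),
            0 ≤ (2 : ℝ) ^ (α * ((j : ℝ) - N)) * tailU α j z := fun j _ =>
          mul_nonneg (by positivity) (tailU_pos α j z).le
        have e1 : ∑ j ∈ Finset.range (A + 1), (2 : ℝ) ^ (α * ((j : ℝ) - A)) *
            (if j < N then tailU α j z else 0) ≤ S := by
          refine le_trans ?_ (Finset.sum_le_sum_of_subset_of_nonneg
            (Finset.range_mono (Nat.le_succ N)) fun j hj _ => hSnn j hj)
          rw [← Finset.sum_subset (Finset.range_mono (show N ≤ A + 1 by omega))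
            fun j _ hj => by rw [if_neg (by simpa using hj), mul_zero]]
          refine Finset.sum_le_sum fun j hj => ?_
          rw [if_pos (Finset.mem_range.1 hj)]
          refine mul_le_mul_of_nonneg_right ?_ (tailU_pos α j z).le
          refine Real.rpow_le_rpow_of_exponent_le one_le_two ?_
          have : (N : ℝ) ≤ A := by exact_mod_cast hN
          gcongr
        have e2 : tailU α N z ≤ S := by
          have := Finset.single_le_sum hSnn (Finset.self_mem_range_succ N)
          simpa using this
        have e3 := hG A
        have e4 : 0 ≤ tailU α N z := (tailU_pos α N z).le
        calc ∑ j ∈ Finset.range (A + 1), (2 : ℝ) ^ (α * ((j : ℝ) - A)) *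
              (2 ^ (-(N : ℝ)) * ((if j < N then tailU α j z else 0) + C * tailU α N z))
            = 2 ^ (-(N : ℝ)) * (∑ j ∈ Finset.range (A + 1), (2 : ℝ) ^ (α * ((j : ℝ) - A)) *
              (if j < N then tailU α j z else 0) +
              (∑ j ∈ Finset.range (A + 1), (2 : ℝ) ^ (α * ((j : ℝ) - A))) * (C * tailU α N z)) := by
              rw [Finset.sum_mul, ← Finset.sum_add_distrib, Finset.mul_sum]
              exact Finset.sum_congr rfl fun j _ => by ring
          _ ≤ 2 ^ (-(N : ℝ)) * (S + G * (C * S)) := by gcongr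
          _ = (1 + G * C) * kernelMajorant α N z := by rw [kernelMajorant]; ring

lemma rpow_sum_le_sum_rpow {ι : Type*} (s : Finset ι) (f : ι → ℝ≥0∞) {p : ℝ} (hp : 0 < p)
    (hp1 : p ≤ 1) : (∑ i ∈ s, f i) ^ p ≤ ∑ i ∈ s, f i ^ p := by
  classical
  induction s using Finset.induction_on with
  | empty => simp [hp]
  | insert a s ha ih =>
    rw [Finset.sum_insert ha, Finset.sum_insert ha]
    exact (ENNReal.rpow_add_le_add_rpow _ _ hp.le hp1).trans (add_le_add_right ih _)

lemma exists_lintegral_kernelMajorant_le {α p : ℝ} (hα : 0 < α) (hp : 0 < p) (hp1 : p ≤ 1)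
    (hαp : 1 < α * p + p) :
    ∃ C : ℝ, 0 ≤ C ∧ ∀ N : ℕ, ∫⁻ z, ENNReal.ofReal (kernelMajorant α N z) ^ p ∂μW ≤
      ENNReal.ofReal (C * 2 ^ (-(N : ℝ))) := by
  obtain ⟨C, hC0, hC⟩ := exists_setLIntegral_tailU_le hα hp hαp
  obtain ⟨G, hG0, hG⟩ := exists_sum_rpow_le (δ := α * p + p - 1) (by linarith)
  refine ⟨C * G, by positivity, fun N => ?_⟩
  have hU : ∀ j, ∫⁻ z, ENNReal.ofReal (tailU α j z) ^ p ∂μW ≤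
      ENNReal.ofReal (C * 2 ^ ((p - 1) * j)) := by
    intro j
    have := hC 0 j 0
    have huniv : cyl 0 0 = Set.univ := by simp [cyl]
    simp only [huniv, Measure.restrict_univ, zero_add, CharP.cast_eq_zero, neg_zero,
      Real.rpow_zero, mul_one, tailU, Real.one_rpow] at this
    refine le_trans (le_of_eq (lintegral_congr fun z => ?_)) this
    rw [ENNReal.ofReal_rpow_of_pos (tailU_pos α j z)]
  have hcoef : ∀ j : ℕ, (0 : ℝ) ≤ 2 ^ (-(N : ℝ)) * 2 ^ (α * ((j : ℝ) - N)) := fun j => by positivity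
  calc ∫⁻ z, ENNReal.ofReal (kernelMajorant α N z) ^ p ∂μW
      ≤ ∫⁻ z, ∑ j ∈ Finset.range (N + 1),
          ENNReal.ofReal (2 ^ (-(N : ℝ)) * 2 ^ (α * ((j : ℝ) - N))) ^ p *
            ENNReal.ofReal (tailU α j z) ^ p ∂μW := by
        refine lintegral_mono fun z => ?_
        rw [kernelMajorant, Finset.mul_sum, ENNReal.ofReal_sum_of_nonneg fun j _ => by
          rw [← mul_assoc]; exact mul_nonneg (hcoef j) (tailU_pos α j z).le]
        refine (rpow_sum_le_sum_rpow _ _ hp hp1).trans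
          (Finset.sum_le_sum fun j _ => le_of_eq ?_)
        rw [← ENNReal.mul_rpow_of_nonneg _ _ hp.le, ← ENNReal.ofReal_mul (hcoef j), mul_assoc]
    _ = ∑ j ∈ Finset.range (N + 1),
          ENNReal.ofReal (2 ^ (-(N : ℝ)) * 2 ^ (α * ((j : ℝ) - N))) ^ p *
            ∫⁻ z, ENNReal.ofReal (tailU α j z) ^ p ∂μW := by
        rw [lintegral_finsetSum]
        · simp only [lintegral_const_mul _ ((measurable_tailU α _).ennreal_ofReal.pow_const p)]
        · exact fun j _ => ((measurable_tailU α j).ennreal_ofReal.pow_const p).const_mul _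
    _ ≤ ∑ j ∈ Finset.range (N + 1),
          ENNReal.ofReal (C * 2 ^ (-(N : ℝ)) * 2 ^ ((α * p + p - 1) * ((j : ℝ) - N))) := by
        refine Finset.sum_le_sum fun j _ => (mul_le_mul_right (hU j) _).trans_eq ?_
        rw [ENNReal.ofReal_rpow_of_nonneg (hcoef j) hp.le, ← ENNReal.ofReal_mul (by positivity),
          Real.mul_rpow (by positivity) (by positivity), ← Real.rpow_mul two_pos.le,
          ← Real.rpow_mul two_pos.le, mul_assoc C, ← Real.rpow_add two_pos,
          ← Real.rpow_add two_pos, mul_left_comm, ← Real.rpow_add two_pos]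
        ring_nf
    _ = ENNReal.ofReal (C * 2 ^ (-(N : ℝ)) *
          ∑ j ∈ Finset.range (N + 1), 2 ^ ((α * p + p - 1) * ((j : ℝ) - N))) := by
        rw [Finset.mul_sum, ENNReal.ofReal_sum_of_nonneg fun j _ => by positivity]
    _ ≤ ENNReal.ofReal (C * G * 2 ^ (-(N : ℝ))) := by
        refine ENNReal.ofReal_le_ofReal ?_
        rw [mul_right_comm]
        have := hG N
        gcongr

end

noncomputable section

section ConeRestriction

variable {d : ℕ} [NeZero d] {γ : Fin d → ℝ → ℝ}

/-- The restriction functions, completed by the identity in the first coordinate. -/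
def crfExt (d : ℕ) [NeZero d] (γ : Fin d → ℝ → ℝ) (j : Fin d) (x : ℝ) : ℝ :=
  if j = 0 then x else γ j x

lemma crfExt_zero (x : ℝ) : crfExt d γ 0 x = x := if_pos rfl

lemma crfExt_of_ne {j : Fin d} (hj : j ≠ 0) : crfExt d γ j = γ j := funext fun _ => if_neg hj

lemma crfExt_mono (hγ : IsCRF d γ) (j : Fin d) {x y : ℝ} (hx : 1 ≤ x) (hxy : x ≤ y) :
    crfExt d γ j x ≤ crfExt d γ j y := by
  by_cases hj : j = 0
  · subst hj; rwa [crfExt_zero, crfExt_zero]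
  · rw [crfExt_of_ne hj]
    exact (hγ.strictMono j hj).monotoneOn hx (hx.trans hxy) hxy

lemma one_le_crfExt (hγ : IsCRF d γ) (j : Fin d) {x : ℝ} (hx : 1 ≤ x) : 1 ≤ crfExt d γ j x := by
  by_cases hj : j = 0
  · subst hj; rwa [crfExt_zero]
  · rw [crfExt_of_ne hj]
    exact hγ.one_le j hj x hx

lemma tendsto_crfExt (hγ : IsCRF d γ) (j : Fin d) : Tendsto (crfExt d γ j) atTop atTop := by
  by_cases hj : j = 0
  · subst hj; exact tendsto_id.congr fun x => (crfExt_zero x).symm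
  · rw [crfExt_of_ne hj]
    exact hγ.tendsto_atTop j hj

lemma exists_crfExt_reg (hγ : IsCRF d γ) : ∃ ζ : ℝ, 1 < ζ ∧ ∀ j : Fin d, ∃ c₁ c₂ : ℝ,
    1 < c₁ ∧ 1 < c₂ ∧ ∀ (k : ℕ) (x : ℝ), 1 ≤ x →
      c₁ ^ k * crfExt d γ j x ≤ crfExt d γ j (ζ ^ k * x) ∧
      crfExt d γ j (ζ ^ k * x) ≤ c₂ ^ k * crfExt d γ j x := by
  obtain ⟨ζ, hζ, H⟩ := hγ.reg
  refine ⟨ζ, hζ, fun j => ?_⟩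
  by_cases hj : j = 0
  · subst hj
    exact ⟨ζ, ζ, hζ, hζ, fun k x _ => by simp only [crfExt_zero, le_refl, and_self]⟩
  · obtain ⟨c₁, c₂, h1, h2, h⟩ := H j hj
    refine ⟨c₁, c₂, h1, h2, fun k x hx => ?_⟩
    rw [crfExt_of_ne hj]
    induction k with
    | zero => simp
    | succ k ih =>
      have hk : 1 ≤ ζ ^ k * x := one_le_mul_of_one_le_of_one_le (one_le_pow₀ hζ.le) hx
      have e : ζ ^ (k + 1) * x = ζ * (ζ ^ k * x) := by ring
      rw [e, pow_succ', pow_succ', mul_assoc, mul_assoc]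
      exact ⟨(mul_le_mul_of_nonneg_left ih.1 (by linarith)).trans (h _ hk).1,
        (h _ hk).2.trans (mul_le_mul_of_nonneg_left ih.2 (by linarith))⟩

lemma exists_crfExt_two_pow_mul_le (hγ : IsCRF d γ) (c : ℕ) :
    ∃ s : ℕ, ∀ (j : Fin d) (x : ℝ), 1 ≤ x →
    crfExt d γ j (2 ^ c * x) ≤ 2 ^ s * crfExt d γ j x := by
  obtain ⟨ζ, hζ, H⟩ := exists_crfExt_reg hγ
  choose c₁ c₂ _ h2 h using H
  obtain ⟨k, hk⟩ := pow_unbounded_of_one_lt ((2 : ℝ) ^ c) hζ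
  have : ∀ j, ∃ s : ℕ, c₂ j ^ k ≤ (2 : ℝ) ^ s := fun j =>
    (pow_unbounded_of_one_lt _ _root_.one_lt_two).imp fun _ => le_of_lt
  choose s hs using this
  refine ⟨∑ j, s j, fun j x hx => ?_⟩
  have h2c : 1 ≤ (2 : ℝ) ^ c * x :=
    one_le_mul_of_one_le_of_one_le (one_le_pow₀ one_le_two) hx
  have hg := one_le_crfExt hγ j hx
  refine (crfExt_mono hγ j h2c (mul_le_mul_of_nonneg_right hk.le (by linarith))).trans
    ((h j k x hx).2.trans (mul_le_mul_of_nonneg_right ((hs j).trans ?_) (by linarith)))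
  exact pow_le_pow_right₀ one_le_two (Finset.single_le_sum (fun _ _ => Nat.zero_le _)
    (Finset.mem_univ j))

lemma exists_mul_crfExt_le (hγ : IsCRF d γ) (B : Fin d → ℝ) :
    ∃ c : ℕ, ∀ (j : Fin d) (x : ℝ), 1 ≤ x →
    B j * crfExt d γ j x ≤ crfExt d γ j (2 ^ c * x) := by
  obtain ⟨ζ, hζ, H⟩ := exists_crfExt_reg hγ
  choose c₁ c₂ h1 _ h using H
  have : ∀ j, ∃ k : ℕ, B j ≤ c₁ j ^ k := fun j =>
    (pow_unbounded_of_one_lt _ (h1 j)).imp fun _ => le_of_lt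
  choose k hk using this
  have : ∀ j, ∃ c : ℕ, ζ ^ k j ≤ (2 : ℝ) ^ c := fun j =>
    (pow_unbounded_of_one_lt _ _root_.one_lt_two).imp fun _ => le_of_lt
  choose c hc using this
  refine ⟨∑ j, c j, fun j x hx => ?_⟩
  have hg := one_le_crfExt hγ j hx
  refine (mul_le_mul_of_nonneg_right (hk j) (by linarith)).trans ((h j (k j) x hx).1.trans
    (crfExt_mono hγ j (one_le_mul_of_one_le_of_one_le (one_le_pow₀ hζ.le) hx)
    (mul_le_mul_of_nonneg_right ((hc j).trans ?_) (by linarith))))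
  exact pow_le_pow_right₀ one_le_two (Finset.single_le_sum (fun _ _ => Nat.zero_le _)
    (Finset.mem_univ j))

lemma bar_eq_log (n₁ : ℕ) (j : Fin d) :
    bar d γ n₁ j = Nat.log 2 ⌊crfExt d γ j ((2 : ℝ) ^ n₁)⌋₊ := by
  by_cases hj : j = 0
  · subst hj
    rw [crfExt_zero, bar, if_pos rfl, show (2 : ℝ) ^ n₁ = ((2 ^ n₁ : ℕ) : ℝ) by push_cast; rfl,
      Nat.floor_natCast, Nat.log_pow one_lt_two]
  · rw [crfExt_of_ne hj, bar, if_neg hj]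

lemma two_pow_bar_le (hγ : IsCRF d γ) (n₁ : ℕ) (j : Fin d) :
    (2 : ℝ) ^ bar d γ n₁ j ≤ crfExt d γ j (2 ^ n₁) := by
  have h1 := one_le_crfExt hγ j (one_le_pow₀ (n := n₁) (one_le_two (α := ℝ)))
  have h2 : ⌊crfExt d γ j ((2 : ℝ) ^ n₁)⌋₊ ≠ 0 := (Nat.floor_pos.2 h1).ne'
  rw [bar_eq_log]
  have h3 : ((2 ^ Nat.log 2 ⌊crfExt d γ j ((2 : ℝ) ^ n₁)⌋₊ : ℕ) : ℝ) ≤ _ :=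
    Nat.cast_le.2 (Nat.pow_log_le_self 2 h2)
  push_cast at h3
  exact h3.trans (Nat.floor_le (by linarith))

lemma crfExt_lt_two_pow_bar (n₁ : ℕ) (j : Fin d) :
    crfExt d γ j (2 ^ n₁) < (2 : ℝ) ^ (bar d γ n₁ j + 1) := by
  rw [bar_eq_log]
  have h3 := Nat.lt_pow_succ_log_self one_lt_two ⌊crfExt d γ j ((2 : ℝ) ^ n₁)⌋₊
  exact_mod_cast (Nat.floor_lt' (by positivity)).1 h3

lemma bar_zero (hγ : IsCRF d γ) (j : Fin d) : bar d γ 0 j = 0 := by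
  by_cases hj : j = 0
  · rw [bar, if_pos hj]
  · rw [bar, if_neg hj, pow_zero, hγ.map_one j hj]; simp

lemma bar_mono (hγ : IsCRF d γ) {m n : ℕ} (h : m ≤ n) (j : Fin d) : bar d γ m j ≤ bar d γ n j := by
  rw [bar_eq_log, bar_eq_log]
  exact Nat.log_mono_right (Nat.floor_mono (crfExt_mono hγ j (one_le_pow₀ one_le_two)
    (pow_le_pow_right₀ one_le_two h)))

lemma exists_bar_succ_le (hγ : IsCRF d γ) : ∃ s : ℕ, ∀ (n₁ : ℕ) (j : Fin d),
    bar d γ (n₁ + 1) j ≤ bar d γ n₁ j + s := by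
  obtain ⟨s, hs⟩ := exists_crfExt_two_pow_mul_le hγ 1
  refine ⟨s + 1, fun n₁ j => ?_⟩
  have h1 := two_pow_bar_le hγ (n₁ + 1) j
  have h2 := hs j (2 ^ n₁) (one_le_pow₀ one_le_two)
  have h3 := crfExt_lt_two_pow_bar (γ := γ) n₁ j
  rw [pow_one, ← pow_succ'] at h2
  have h4 : (2 : ℝ) ^ bar d γ (n₁ + 1) j ≤ 2 ^ (bar d γ n₁ j + (s + 1)) := by
    refine h1.trans (h2.trans ((mul_le_mul_of_nonneg_left h3.le (by positivity)).trans_eq ?_))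
    rw [← pow_add]; ring_nf
  exact (pow_le_pow_iff_right₀ _root_.one_lt_two).1 h4

lemma exists_le_two_pow_bar (hγ : IsCRF d γ) (M : ℕ) : ∃ K : ℕ, ∀ j, M ≤ 2 ^ bar d γ K j := by
  have h : ∀ j, ∀ᶠ K : ℕ in atTop, (2 * M : ℝ) ≤ crfExt d γ j (2 ^ K) := fun j =>
    ((tendsto_crfExt hγ j).comp
      (tendsto_pow_atTop_atTop_of_one_lt one_lt_two)).eventually_ge_atTop _
  obtain ⟨K, hK⟩ := (eventually_all.2 h).exists
  refine ⟨K, fun j => ?_⟩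
  have h1 := (hK j).trans (crfExt_lt_two_pow_bar K j).le
  rw [pow_succ'] at h1
  exact_mod_cast le_of_mul_le_mul_left h1 two_pos

/-- The indices of a cone-like set are, relative to the scale `n₁`, either small in all coordinates
or large in all coordinates. -/
lemma exists_coneLike_dichotomy (hγ : IsCRF d γ) {β : Fin d → ℝ} (hβ : ∀ j, j ≠ 0 → 1 ≤ β j) :
    ∃ s : ℕ, ∀ n ∈ coneLike d γ β, n 0 ≠ 0 → ∀ n₁, (∀ j, n j ≤ 2 ^ bar d γ n₁ j) ∨
      ∀ j, n j ≠ 0 ∧ 2 ^ bar d γ n₁ j ≤ 2 ^ s * n j := by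
  set B : Fin d → ℝ := fun j => if j = 0 then 1 else β j with hB
  have hB1 : ∀ j, 1 ≤ B j := fun j => by
    by_cases hj : j = 0
    · simp [hB, hj]
    · simp [hB, hj, hβ j hj]
  obtain ⟨c, hc⟩ := exists_mul_crfExt_le hγ fun j => 2 * B j
  obtain ⟨s, hs⟩ := exists_crfExt_two_pow_mul_le hγ c
  have : ∀ j, ∃ k : ℕ, B j ≤ (2 : ℝ) ^ k := fun j =>
    (pow_unbounded_of_one_lt _ _root_.one_lt_two).imp fun _ => le_of_lt
  choose k hk using this
  refine ⟨s + ∑ j, k j, fun n hn h0 n₁ => ?_⟩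
  have hn0 : (1 : ℝ) ≤ n 0 := by exact_mod_cast Nat.one_le_iff_ne_zero.2 h0
  have hcone : ∀ j, crfExt d γ j (n 0) ≤ B j * n j ∧ (n j : ℝ) ≤ B j * crfExt d γ j (n 0) := by
    intro j
    by_cases hj : j = 0
    · subst hj; simp [hB, crfExt_zero]
    · have hβj : 0 < β j := by linarith [hβ j hj]
      rw [crfExt_of_ne hj, show B j = β j from if_neg hj]
      exact ⟨(inv_mul_le_iff₀ hβj).1 (hn j hj).1, (hn j hj).2⟩
  have hc1 : 1 ≤ (2 : ℝ) ^ c * n 0 := one_le_mul_of_one_le_of_one_le (one_le_pow₀ one_le_two) hn0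
  by_cases hsmall : (2 : ℝ) ^ c * n 0 ≤ 2 ^ n₁
  · refine Or.inl fun j => ?_
    have h1 := (hc j (n 0) hn0).trans ((crfExt_mono hγ j hc1 hsmall).trans
      (crfExt_lt_two_pow_bar n₁ j).le)
    have h2 := (hcone j).2
    rw [pow_succ'] at h1
    have h3 : (n j : ℝ) ≤ 2 ^ bar d γ n₁ j := by linarith
    exact_mod_cast h3
  · refine Or.inr fun j => ?_
    have hpos := one_le_crfExt hγ j hn0
    have h1 := (hcone j).1
    refine ⟨fun h => ?_, ?_⟩
    · rw [h, Nat.cast_zero, mul_zero] at h1; linarith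
    · have h2 := (two_pow_bar_le hγ n₁ j).trans ((crfExt_mono hγ j (one_le_pow₀ one_le_two)
        (not_le.1 hsmall).le).trans (hs j _ hn0))
      have h3 : B j ≤ (2 : ℝ) ^ ∑ j, k j := (hk j).trans (pow_le_pow_right₀ one_le_two
        (Finset.single_le_sum (fun _ _ => Nat.zero_le _) (Finset.mem_univ j)))
      have h4 : (2 : ℝ) ^ bar d γ n₁ j ≤ 2 ^ (s + ∑ j, k j) * n j := by
        rw [pow_add, mul_assoc]
        exact h2.trans (mul_le_mul_of_nonneg_left
          (h1.trans (mul_le_mul_of_nonneg_right h3 (Nat.cast_nonneg _))) (by positivity))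
      exact_mod_cast h4

end ConeRestriction

end

noncomputable section

section Product

variable {d : ℕ}

instance : IsProbabilityMeasure (μD d) := by unfold μD; infer_instance

instance : (μD d).IsAddLeftInvariant := by unfold μD; infer_instance

lemma rectAt_eq_pi (N : Fin d → ℕ) (y : Fin d → WG) :
    rectAt d N y = Set.univ.pi fun j => cyl (N j) (y j) := by
  ext x; simp [rectAt, cyl]

lemma measurableSet_rectAt (N : Fin d → ℕ) (y : Fin d → WG) : MeasurableSet (rectAt d N y) := by
  rw [rectAt_eq_pi]
  exact MeasurableSet.univ_pi fun j => measurableSet_cyl _ _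

lemma μD_rectAt (N : Fin d → ℕ) (y : Fin d → WG) :
    μD d (rectAt d N y) = ∏ j, (2⁻¹ : ℝ≥0∞) ^ N j := by
  rw [rectAt_eq_pi, μD, Measure.pi_pi]
  exact Finset.prod_congr rfl fun j _ => μW_cyl _ _

lemma lintegral_prod_μD {φ : Fin d → WG → ℝ≥0∞} (hφ : ∀ i, Measurable (φ i)) :
    ∫⁻ x, ∏ i, φ i (x i) ∂μD d = ∏ i, ∫⁻ t, φ i t ∂μW := by
  rw [μD, ProbabilityTheory.lintegral_prod_eq_prod_lintegral_of_indepFun Finset.univ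
    (fun (i : Fin d) (x : Fin d → WG) => φ i (x i))
    (ProbabilityTheory.iIndepFun_pi (μ := fun _ => μW) fun i => (hφ i).aemeasurable)
    fun i => (hφ i).comp (measurable_pi_apply i)]
  refine Finset.prod_congr rfl fun i _ => ?_
  exact (measurePreserving_eval (fun _ : Fin d => μW) i).lintegral_comp (hφ i)

lemma setLIntegral_rectAt_prod {φ : Fin d → WG → ℝ≥0∞} (hφ : ∀ i, Measurable (φ i))
    (N : Fin d → ℕ) (y : Fin d → WG) :
    ∫⁻ x in rectAt d N y, ∏ i, φ i (x i) ∂μD d = ∏ i, ∫⁻ t in cyl (N i) (y i), φ i t ∂μW := by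
  rw [← lintegral_indicator (measurableSet_rectAt N y)]
  simp only [← lintegral_indicator (measurableSet_cyl _ _)]
  rw [← lintegral_prod_μD fun i => (hφ i).indicator (measurableSet_cyl _ _)]
  refine lintegral_congr fun x => ?_
  by_cases hx : x ∈ rectAt d N y
  · rw [Set.indicator_of_mem hx]
    exact Finset.prod_congr rfl fun i _ =>
      (Set.indicator_of_mem (s := cyl (N i) (y i)) (hx i) _).symm
  · rw [Set.indicator_of_notMem hx]
    obtain ⟨i, hi⟩ : ∃ i, x i ∉ cyl (N i) (y i) := by
      rw [rectAt_eq_pi, Set.mem_univ_pi] at hx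
      exact not_forall.1 hx
    exact (Finset.prod_eq_zero (Finset.mem_univ i) (Set.indicator_of_notMem hi _)).symm

lemma setLIntegral_cyl_add (N : ℕ) (x y : WG) {φ : WG → ℝ≥0∞} :
    ∫⁻ t in cyl N y, φ (x + t) ∂μW = ∫⁻ t in cyl N (x + y), φ t ∂μW := by
  rw [← lintegral_indicator (measurableSet_cyl _ _), ← lintegral_indicator (measurableSet_cyl _ _),
    ← lintegral_add_left_eq_self ((cyl N (x + y)).indicator φ) x]
  refine lintegral_congr fun t => ?_
  have : x + t ∈ cyl N (x + y) ↔ t ∈ cyl N y :=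
    forall_congr' fun i => imp_congr_right fun _ => add_right_inj (x i)
  by_cases ht : t ∈ cyl N y
  · rw [Set.indicator_of_mem ht, Set.indicator_of_mem (this.2 ht)]
  · rw [Set.indicator_of_notMem ht, Set.indicator_of_notMem (mt this.1 ht)]

lemma measurable_coord_val (i : ℕ) : Measurable fun x : WG => (x i).val :=
  (measurable_of_finite ZMod.val).comp (measurable_pi_apply (X := fun _ => ZMod 2) i)

lemma measurable_neg_one_pow {X : Type*} [MeasurableSpace X] {f : X → ℕ} (hf : Measurable f) :
    Measurable fun x => (-1 : ℝ) ^ f x :=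
  (measurable_from_top (f := fun n : ℕ => (-1 : ℝ) ^ n)).comp hf

lemma measurable_kacz (m : ℕ) : Measurable (kacz m) := by
  by_cases hm : m = 0
  · subst hm
    exact measurable_const
  · unfold kacz
    simp only [if_neg hm]
    exact (measurable_neg_one_pow (measurable_coord_val _)).mul (measurable_neg_one_pow
      (Finset.measurable_fun_sum _ fun k _ => (measurable_coord_val _).const_mul _))

lemma measurable_KK (α : ℝ) (n : ℕ) : Measurable (KK α n) :=
  (Finset.measurable_fun_sum _ fun _ _ => (Finset.measurable_fun_sum _ fun _ _ =>
    measurable_kacz _).const_mul _).const_mul _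

lemma KK_zero (α : ℝ) (x : WG) : KK α 0 x = 0 := by simp [KK, dirK]

lemma dirK_congr {N k : ℕ} (hk : k ≤ 2 ^ N) {x y : WG} (h : ∀ i < N, x i = y i) :
    dirK k x = dirK k y :=
  Finset.sum_congr rfl fun _ hm => kacz_congr ((Finset.mem_range.1 hm).trans_le hk) h

lemma KK_congr (α : ℝ) {N n : ℕ} (hn : n ≤ 2 ^ N) {x y : WG} (h : ∀ i < N, x i = y i) :
    KK α n x = KK α n y := by
  unfold KK
  congr 1
  refine Finset.sum_congr rfl fun k hk => ?_
  rw [dirK_congr ((Nat.lt_succ_iff.1 (Finset.mem_range.1 hk)).trans hn) h]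

/-- The `d`-dimensional Walsh–Kaczmarz Cesàro kernel. -/
def KKD (d : ℕ) (α : Fin d → ℝ) (n : Fin d → ℕ) (x : Fin d → WG) : ℝ :=
  ∏ i, KK (α i) (n i) (x i)

lemma measurable_kaczD (m : Fin d → ℕ) : Measurable (kaczD d m) :=
  Finset.measurable_fun_prod _ fun i _ => (measurable_kacz _).comp (measurable_pi_apply i)

lemma abs_kaczD (m : Fin d → ℕ) (x : Fin d → WG) : |kaczD d m x| = 1 := by
  rw [kaczD, Finset.abs_prod]
  exact Finset.prod_eq_one fun i _ => abs_kacz _ _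

lemma kaczD_add (m : Fin d → ℕ) (x t : Fin d → WG) :
    kaczD d m (x + t) = kaczD d m x * kaczD d m t := by
  simp only [kaczD, Pi.add_apply, kacz_add, Finset.prod_mul_distrib]

lemma kaczD_congr {m N : Fin d → ℕ} (hm : ∀ i, m i < 2 ^ N i) {x y : Fin d → WG}
    (h : x ∈ rectAt d N y) : kaczD d m x = kaczD d m y :=
  Finset.prod_congr rfl fun i _ => kacz_congr (hm i) (h i)

lemma prod_sum_range_eq (k : Fin d → ℕ) (g : Fin d → ℕ → ℝ) :
    ∏ i, ∑ m ∈ Finset.range (k i), g i m =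
      ∑ m ∈ Fintype.piFinset (fun i => Finset.range (k i)), ∏ i, g i (m i) :=
  Finset.prod_univ_sum _ _

lemma KKD_add_eq_cesaroOf (α : Fin d → ℝ) (n : Fin d → ℕ) (x t : Fin d → WG) :
    KKD d α n (x + t) = cesaroOf d α (fun m => kaczD d m t) n x := by
  simp only [KKD, KK, cesaroOf, Finset.prod_mul_distrib, Finset.prod_inv_distrib,
    prod_sum_range_eq]
  congr 1
  refine Finset.sum_congr rfl fun k _ => ?_
  congr 1
  simp only [dirK, prod_sum_range_eq, partialSumOf]
  refine Finset.sum_congr rfl fun m _ => ?_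
  rw [mul_comm, ← kaczD_add]; rfl

lemma integrable_mul_kaczD {f : (Fin d → WG) → ℝ} (hf : Integrable f (μD d)) (m : Fin d → ℕ) :
    Integrable (fun t => f t * kaczD d m t) (μD d) :=
  hf.mul_bdd (c := 1) (measurable_kaczD m).aestronglyMeasurable
    (ae_of_all _ fun t => (abs_kaczD m t).le)

lemma cesaroOf_fCoeff {f : (Fin d → WG) → ℝ} (hf : Integrable f (μD d)) (α : Fin d → ℝ)
    (n : Fin d → ℕ) (x : Fin d → WG) :
    cesaroOf d α (fCoeff d f) n x = ∫ t, f t * KKD d α n (x + t) ∂μD d := by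
  have h : ∀ t, f t * KKD d α n (x + t) = cesaroOf d α (fun m => f t * kaczD d m t) n x := by
    intro t
    rw [KKD_add_eq_cesaroOf]
    simp only [cesaroOf, partialSumOf, Finset.mul_sum]
    refine Finset.sum_congr rfl fun k _ => Finset.sum_congr rfl fun m _ => ?_
    ring
  simp only [h, cesaroOf, partialSumOf, fCoeff]
  have hi : ∀ m : Fin d → ℕ, Integrable (fun t => f t * kaczD d m t * kaczD d m x) (μD d) :=
    fun m => (integrable_mul_kaczD hf m).mul_const _
  rw [integral_const_mul, integral_finsetSum _ fun k _ =>
    (integrable_finsetSum _ fun m _ => hi m).const_mul _]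
  simp only [integral_const_mul, integral_finsetSum _ fun m _ => hi m, integral_mul_const]

lemma cesaroOf_fCoeff_add {f g : (Fin d → WG) → ℝ} (hf : Integrable f (μD d))
    (hg : Integrable g (μD d)) (α : Fin d → ℝ) (n : Fin d → ℕ) (x : Fin d → WG) :
    cesaroOf d α (fCoeff d (f + g)) n x =
      cesaroOf d α (fCoeff d f) n x + cesaroOf d α (fCoeff d g) n x := by
  have : fCoeff d (f + g) = fun m => fCoeff d f m + fCoeff d g m := by
    ext m
    simp only [fCoeff, Pi.add_apply, add_mul]
    exact integral_add (integrable_mul_kaczD hf m) (integrable_mul_kaczD hg m)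
  simp only [this, cesaroOf, partialSumOf, add_mul, Finset.sum_add_distrib, mul_add]

lemma measurable_cesaroOf (α : Fin d → ℝ) (c : (Fin d → ℕ) → ℝ) (n : Fin d → ℕ) :
    Measurable (cesaroOf d α c n) :=
  (Finset.measurable_fun_sum _ fun _ _ => (Finset.measurable_fun_sum _ fun _ _ =>
    (measurable_kaczD _).const_mul _).const_mul _).const_mul _

end Product

section Maximal

variable {d : ℕ} [NeZero d] {α : Fin d → ℝ} {γ : Fin d → ℝ → ℝ} {β : Fin d → ℝ}

lemma measurable_cesaroMaximal (c : (Fin d → ℕ) → ℝ) : Measurable (cesaroMaximal d α γ β c) :=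
  Measurable.biSup _ (Set.to_countable _) fun n _ => (measurable_cesaroOf α c n).abs.ennreal_ofReal

lemma cesaroMaximal_add_le {f g : (Fin d → WG) → ℝ} (hf : Integrable f (μD d))
    (hg : Integrable g (μD d)) (x : Fin d → WG) :
    cesaroMaximal d α γ β (fCoeff d (f + g)) x ≤
      cesaroMaximal d α γ β (fCoeff d f) x + cesaroMaximal d α γ β (fCoeff d g) x := by
  refine iSup₂_le fun n hn => ?_
  rw [cesaroOf_fCoeff_add hf hg]
  refine (ENNReal.ofReal_le_ofReal (abs_add_le _ _)).trans (ENNReal.ofReal_add_le.trans ?_)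
  exact add_le_add (le_iSup₂_of_le n hn le_rfl) (le_iSup₂_of_le n hn le_rfl)

lemma cesaroMaximal_zero (x : Fin d → WG) : cesaroMaximal d α γ β (fCoeff d 0) x = 0 := by
  simp [cesaroMaximal, cesaroOf, partialSumOf, fCoeff]

/-- On a function of mean zero supported on a dyadic rectangle, the maximal operator is dominated by
a product of one-dimensional kernel majorants. -/
lemma exists_cesaroMaximal_le_prod (hα : ∀ i, 0 < α i ∧ α i ≤ 1) (hγ : IsCRF d γ)
    (hβ : ∀ j, j ≠ 0 → 1 ≤ β j) : ∃ (s : ℕ) (C : Fin d → ℝ), (∀ i, 0 ≤ C i) ∧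
      ∀ (n₁ : ℕ) (y : Fin d → WG) (b : (Fin d → WG) → ℝ) (lam : ℝ), Measurable b →
      (∀ x, |b x| ≤ lam) → (∀ x ∉ rectAt d (bar d γ n₁) y, b x = 0) →
      (n₁ = 0 ∨ ∫ x, b x ∂μD d = 0) → ∀ x, cesaroMaximal d α γ β (fCoeff d b) x ≤
        ENNReal.ofReal lam * ∏ i, ENNReal.ofReal
          (C i * kernelMajorant (α i) (bar d γ n₁ i - s) (y i + x i)) := by
  obtain ⟨s, hs⟩ := exists_coneLike_dichotomy hγ hβ
  choose C hC0 hC using fun i => exists_setLIntegral_KK_le (hα i).1 (hα i).2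
  refine ⟨s, C, hC0, fun n₁ y b lam hb hlam hsupp hmean x => iSup₂_le fun n hn => ?_⟩
  set N := bar d γ n₁ with hN
  have hbi : Integrable b (μD d) := Integrable.of_bound hb.aestronglyMeasurable lam
    (ae_of_all _ hlam)
  rw [cesaroOf_fCoeff hbi]
  by_cases h0 : n 0 = 0
  · have : ∀ t, KKD d α n (x + t) = 0 := fun t =>
      Finset.prod_eq_zero (Finset.mem_univ 0) (by rw [h0, KK_zero])
    simp [this]
  have key : ∀ j, n j ≠ 0 ∧ 2 ^ N j ≤ 2 ^ s * n j → N j - s ≤ Nat.log 2 (n j) := fun j hj => by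
    refine Nat.le_log_of_pow_le one_lt_two ?_
    by_cases hNs : s ≤ N j
    · have := hj.2
      rw [← Nat.add_sub_of_le hNs, pow_add] at this
      exact Nat.le_of_mul_le_mul_left this (by positivity)
    · rw [Nat.sub_eq_zero_of_le (by omega), pow_zero]; exact Nat.one_le_iff_ne_zero.2 hj.1
  have large : (∀ j, n j ≠ 0 ∧ N j - s ≤ Nat.log 2 (n j)) →
      ENNReal.ofReal |∫ t, b t * KKD d α n (x + t) ∂μD d| ≤ ENNReal.ofReal lam *
        ∏ i, ENNReal.ofReal (C i * kernelMajorant (α i) (N i - s) (y i + x i)) := by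
    intro h
    have hm : ∀ i, Measurable fun t : WG => ENNReal.ofReal |KK (α i) (n i) (x i + t)| := fun i =>
      ((measurable_KK _ _).comp (measurable_const_add (x i))).abs.ennreal_ofReal
    calc ENNReal.ofReal |∫ t, b t * KKD d α n (x + t) ∂μD d|
        ≤ ∫⁻ t, ENNReal.ofReal |b t * KKD d α n (x + t)| ∂μD d := by
          simpa only [← Real.enorm_eq_ofReal_abs] using enorm_integral_le_lintegral_enorm _
      _ ≤ ∫⁻ t, (rectAt d N y).indicator (fun t => ENNReal.ofReal lam *
            ∏ i, ENNReal.ofReal |KK (α i) (n i) (x i + t i)|) t ∂μD d := by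
          refine lintegral_mono fun t => ?_
          by_cases ht : t ∈ rectAt d N y
          · rw [Set.indicator_of_mem ht, abs_mul, ENNReal.ofReal_mul (abs_nonneg _), KKD,
              Finset.abs_prod, ENNReal.ofReal_prod_of_nonneg fun i _ => abs_nonneg _]
            exact mul_le_mul_left (ENNReal.ofReal_le_ofReal (hlam t)) _
          · simp [hsupp t ht]
      _ = ENNReal.ofReal lam * ∏ i, ∫⁻ t in cyl (N i) (x i + y i),
            ENNReal.ofReal |KK (α i) (n i) t| ∂μW := by
          rw [lintegral_indicator (measurableSet_rectAt N y), lintegral_const_mul',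
            setLIntegral_rectAt_prod hm]
          · congr 1
            exact Finset.prod_congr rfl fun i _ =>
              setLIntegral_cyl_add _ _ _ (φ := fun t => ENNReal.ofReal |KK (α i) (n i) t|)
          · exact ENNReal.ofReal_ne_top
      _ ≤ _ := by
          gcongr with i
          rw [add_comm (x i)]
          refine le_trans (lintegral_mono_set fun t ht => ?_)
            (hC i (n i) (N i - s) (y i + x i) (h i).1 (h i).2)
          exact fun k hk => ht k (by omega)
  rcases hs n hn h0 n₁ with h | h
  · rcases hmean with rfl | hmean
    · by_cases hz : ∃ j, n j = 0
      · obtain ⟨j, hj⟩ := hz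
        have : ∀ t, KKD d α n (x + t) = 0 := fun t =>
          Finset.prod_eq_zero (Finset.mem_univ j) (by rw [hj, KK_zero])
        simp [this]
      · refine large fun j => ⟨fun hj => hz ⟨j, hj⟩, ?_⟩
        rw [hN, bar_zero hγ, Nat.zero_sub]
        exact Nat.zero_le _
    · have : ∀ t, b t * KKD d α n (x + t) = b t * KKD d α n (x + y) := by
        intro t
        by_cases ht : t ∈ rectAt d N y
        · congr 1
          refine Finset.prod_congr rfl fun i _ => KK_congr _ (h i) fun k hk => ?_
          rw [Pi.add_apply, Pi.add_apply, Pi.add_apply, Pi.add_apply, ht i k hk]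
        · rw [hsupp t ht, zero_mul, zero_mul]
      simp only [this, integral_mul_const, hmean, zero_mul, abs_zero, ENNReal.ofReal_zero, zero_le]
  · exact large fun j => ⟨(h j).1, key j (h j)⟩

/-- Uniform `L^p` estimate for bounded functions of mean zero supported on dyadic rectangles. -/
lemma exists_lintegral_cesaroMaximal_le (hα : ∀ i, 0 < α i ∧ α i ≤ 1) (hγ : IsCRF d γ)
    (hβ : ∀ j, j ≠ 0 → 1 ≤ β j) {p : ℝ} (hp : 0 < p) (hp1 : p ≤ 1)
    (hαp : ∀ i, 1 < α i * p + p) : ∃ C : ℝ≥0∞, C ≠ ⊤ ∧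
      ∀ (n₁ : ℕ) (y : Fin d → WG) (b : (Fin d → WG) → ℝ) (lam : ℝ), Measurable b →
      (∀ x, |b x| ≤ lam) → (∀ x ∉ rectAt d (bar d γ n₁) y, b x = 0) →
      (n₁ = 0 ∨ ∫ x, b x ∂μD d = 0) →
      ∫⁻ x, cesaroMaximal d α γ β (fCoeff d b) x ^ p ∂μD d ≤
        C * ENNReal.ofReal lam ^ p * μD d (rectAt d (bar d γ n₁) y) := by
  obtain ⟨s, C, hC0, H⟩ := exists_cesaroMaximal_le_prod hα hγ hβ
  choose G hG0 hG using fun i => exists_lintegral_kernelMajorant_le (hα i).1 hp hp1 (hαp i)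
  refine ⟨∏ i, (ENNReal.ofReal (C i) ^ p * (ENNReal.ofReal (G i) * 2 ^ s)), ?_, ?_⟩
  · exact (ENNReal.prod_lt_top fun i _ => ENNReal.mul_lt_top
      (ENNReal.rpow_lt_top_of_nonneg hp.le ENNReal.ofReal_ne_top)
      (ENNReal.mul_lt_top ENNReal.ofReal_lt_top (by finiteness))).ne
  intro n₁ y b lam hb hlam hsupp hmean
  set N := bar d γ n₁
  have hm : ∀ i, Measurable fun t : WG =>
      ENNReal.ofReal (kernelMajorant (α i) (N i - s) t) ^ p := fun i =>
    (measurable_kernelMajorant _ _).ennreal_ofReal.pow_const p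
  have hm' : ∀ i, Measurable fun t : WG =>
      ENNReal.ofReal (kernelMajorant (α i) (N i - s) (y i + t)) ^ p := fun i =>
    (hm i).comp (measurable_const_add (y i))
  calc ∫⁻ x, cesaroMaximal d α γ β (fCoeff d b) x ^ p ∂μD d
      ≤ ∫⁻ x, ENNReal.ofReal lam ^ p * ∏ i, (ENNReal.ofReal (C i) ^ p *
          ENNReal.ofReal (kernelMajorant (α i) (N i - s) (y i + x i)) ^ p) ∂μD d := by
        refine lintegral_mono fun x => (ENNReal.rpow_le_rpow
          (H n₁ y b lam hb hlam hsupp hmean x) hp.le).trans_eq ?_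
        rw [ENNReal.mul_rpow_of_nonneg _ _ hp.le, ← ENNReal.prod_rpow_of_nonneg hp.le]
        simp only [ENNReal.ofReal_mul (hC0 _), ENNReal.mul_rpow_of_nonneg _ _ hp.le, N]
    _ = ENNReal.ofReal lam ^ p * ∏ i, (ENNReal.ofReal (C i) ^ p *
          ∫⁻ t, ENNReal.ofReal (kernelMajorant (α i) (N i - s) t) ^ p ∂μW) := by
        rw [lintegral_const_mul', lintegral_prod_μD (φ := fun i t => ENNReal.ofReal (C i) ^ p *
          ENNReal.ofReal (kernelMajorant (α i) (N i - s) (y i + t)) ^ p)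
          fun i => (hm' i).const_mul _]
        · congr 1
          refine Finset.prod_congr rfl fun i _ => ?_
          rw [lintegral_const_mul _ (hm' i), lintegral_add_left_eq_self
            (fun t => ENNReal.ofReal (kernelMajorant (α i) (N i - s) t) ^ p)]
        · exact ENNReal.rpow_ne_top_of_nonneg hp.le ENNReal.ofReal_ne_top
    _ ≤ ENNReal.ofReal lam ^ p * ∏ i, (ENNReal.ofReal (C i) ^ p *
          (ENNReal.ofReal (G i) * 2 ^ s * 2⁻¹ ^ N i)) := by
        gcongr with i
        refine (hG i _).trans ?_
        rw [ENNReal.ofReal_mul (hG0 i), ← μW_cyl_ofReal _ 0, μW_cyl, mul_assoc]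
        gcongr
        have h2 : (2 : ℝ≥0∞) * 2⁻¹ = 1 := ENNReal.mul_inv_cancel two_ne_zero ENNReal.ofNat_ne_top
        have e : (2⁻¹ : ℝ≥0∞) ^ (N i - s) = 2 ^ s * 2⁻¹ ^ (s + (N i - s)) := by
          rw [pow_add, ← mul_assoc, ← mul_pow, h2, one_pow, one_mul]
        rw [e]
        gcongr 2 ^ s * ?_
        exact pow_le_pow_right_of_le_one' (by simp) (by omega)
    _ = _ := by
        rw [μD_rectAt]
        simp only [Finset.prod_mul_distrib]
        ring

end Maximal

end

noncomputable section

section Levels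

variable {d : ℕ}

lemma mem_rectAt_self (N : Fin d → ℕ) (y : Fin d → WG) : y ∈ rectAt d N y := fun _ _ _ => rfl

lemma mem_rectAt_comm {N : Fin d → ℕ} {x y : Fin d → WG} : x ∈ rectAt d N y ↔ y ∈ rectAt d N x :=
  ⟨fun h j i hi => (h j i hi).symm, fun h j i hi => (h j i hi).symm⟩

lemma mem_rectAt_trans {N : Fin d → ℕ} {x y z : Fin d → WG} (h : x ∈ rectAt d N y)
    (h' : y ∈ rectAt d N z) : x ∈ rectAt d N z :=
  fun j i hi => (h j i hi).trans (h' j i hi)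

lemma rectAt_anti {M N : Fin d → ℕ} (h : ∀ j, M j ≤ N j) (y : Fin d → WG) :
    rectAt d N y ⊆ rectAt d M y := fun _ hx j i hi => hx j i (hi.trans_le (h j))

/-- The digits which determine the dyadic rectangle of level `N` of a point. -/
def digits (N : Fin d → ℕ) (x : Fin d → WG) : ∀ j, Fin (N j) → ZMod 2 := fun j i => x j i

/-- The point with prescribed first digits, all other digits being zero. -/
def ofDigits (N : Fin d → ℕ) (c : ∀ j, Fin (N j) → ZMod 2) : Fin d → WG :=
  fun j i => if h : i < N j then c j ⟨i, h⟩ else 0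

lemma mem_rectAt_ofDigits {N : Fin d → ℕ} {c : ∀ j, Fin (N j) → ZMod 2} {x : Fin d → WG} :
    x ∈ rectAt d N (ofDigits N c) ↔ digits N x = c := by
  constructor
  · intro h
    funext j i
    simpa [ofDigits, digits] using h j i i.2
  · rintro rfl j i hi
    simp [ofDigits, digits, hi]

lemma measurable_digits (N : Fin d → ℕ) : Measurable (digits N) :=
  measurable_pi_lambda _ fun j => measurable_pi_lambda _ fun i =>
    (measurable_pi_apply (X := fun _ => ZMod 2) (i : ℕ)).comp (measurable_pi_apply j)

/-- Measurability with respect to the `σ`-algebra generated by the rectangles of level `N`. -/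
def IsLevel (N : Fin d → ℕ) {β : Type*} (φ : (Fin d → WG) → β) : Prop :=
  ∀ x y, x ∈ rectAt d N y → φ x = φ y

namespace IsLevel

variable {N M : Fin d → ℕ} {β : Type*}

lemma mono {φ : (Fin d → WG) → β} (h : IsLevel M φ) (hMN : ∀ j, M j ≤ N j) : IsLevel N φ :=
  fun x y hxy => h x y (rectAt_anti hMN y hxy)

lemma eq_comp {φ : (Fin d → WG) → β} (h : IsLevel N φ) :
    φ = (fun c => φ (ofDigits N c)) ∘ digits N :=
  funext fun _ => h _ _ (mem_rectAt_ofDigits.2 rfl)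

lemma measurable [MeasurableSpace β] {φ : (Fin d → WG) → β} (h : IsLevel N φ) : Measurable φ := by
  rw [h.eq_comp]
  exact (measurable_of_finite _).comp (measurable_digits N)

lemma exists_abs_le {φ : (Fin d → WG) → ℝ} (h : IsLevel N φ) : ∃ B, ∀ x, |φ x| ≤ B := by
  obtain ⟨B, hB⟩ := (Set.finite_range fun c => |φ (ofDigits N c)|).bddAbove
  exact ⟨B, fun x => by
    rw [h.eq_comp]; exact hB ⟨digits N x, rfl⟩⟩

lemma integrable {φ : (Fin d → WG) → ℝ} (h : IsLevel N φ) : Integrable φ (μD d) := by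
  obtain ⟨B, hB⟩ := h.exists_abs_le
  exact Integrable.of_bound h.measurable.aestronglyMeasurable B (ae_of_all _ hB)

lemma mul_eq_sum {φ u : (Fin d → WG) → ℝ} (h : IsLevel N φ) (x : Fin d → WG) :
    φ x * u x = ∑ c, φ (ofDigits N c) * (rectAt d N (ofDigits N c)).indicator u x := by
  rw [Finset.sum_eq_single (digits N x)]
  · rw [Set.indicator_of_mem (mem_rectAt_ofDigits.2 rfl), h _ _ (mem_rectAt_ofDigits.2 rfl)]
  · intro c _ hc
    rw [Set.indicator_of_notMem (mt mem_rectAt_ofDigits.1 (Ne.symm hc)), mul_zero]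
  · simp

lemma integral_mul {φ u : (Fin d → WG) → ℝ} (h : IsLevel N φ) (hu : Integrable u (μD d)) :
    ∫ x, φ x * u x ∂μD d =
      ∑ c, φ (ofDigits N c) * ∫ x in rectAt d N (ofDigits N c), u x ∂μD d := by
  simp only [h.mul_eq_sum]
  rw [integral_finsetSum _ fun c _ => (hu.indicator (measurableSet_rectAt _ _)).const_mul _]
  simp only [integral_const_mul, integral_indicator (measurableSet_rectAt _ _)]

end IsLevel

end Levels

section MartingaleDecomposition

variable {d : ℕ} [NeZero d] {γ : Fin d → ℝ → ℝ} (f : ConeMartingale d γ)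

lemma isLevel_F (n : ℕ) : IsLevel (bar d γ n) (f.F n) := f.adapted n

lemma integral_mul_F {k m : ℕ} (h : k ≤ m) {φ : (Fin d → WG) → ℝ} (hφ : IsLevel (bar d γ k) φ) :
    ∫ x, φ x * f.F m x ∂μD d = ∫ x, φ x * f.F k x ∂μD d := by
  rw [hφ.integral_mul (f.integrable m), hφ.integral_mul (f.integrable k)]
  simp only [f.mart k m h]

lemma martCoeff_eq {K : ℕ} {m : Fin d → ℕ} (hm : ∀ j, m j < 2 ^ bar d γ K j) :
    martCoeff d γ f m = fCoeff d (f.F K) m := by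
  refine Tendsto.limUnder_eq (tendsto_const_nhds.congr' ?_)
  filter_upwards [eventually_ge_atTop K] with k hk
  simp only [fCoeff, mul_comm _ (kaczD d m _)]
  exact (integral_mul_F f hk fun x y h => kaczD_congr hm h).symm

/-- Up to level `n` and one step beyond it, the martingale stays below the threshold `lam` on the
dyadic rectangles of `x`. -/
def StaysBelow (lam : ℝ) (n : ℕ) (x : Fin d → WG) : Prop :=
  ∀ m ≤ n, |f.F m x| ≤ lam ∧ ∀ y ∈ rectAt d (bar d γ m) x, |f.F (m + 1) y| ≤ lam

variable {f} {lam : ℝ}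

lemma StaysBelow.of_le {m n : ℕ} (hmn : m ≤ n) {x : Fin d → WG} (h : StaysBelow f lam n x) :
    StaysBelow f lam m x := fun k hk => h k (hk.trans hmn)

lemma StaysBelow.mono {n : ℕ} {lam' : ℝ} (hl : lam ≤ lam') {x : Fin d → WG}
    (h : StaysBelow f lam n x) : StaysBelow f lam' n x :=
  fun k hk => ⟨(h k hk).1.trans hl, fun y hy => ((h k hk).2 y hy).trans hl⟩

lemma isLevel_staysBelow (hγ : IsCRF d γ) (lam : ℝ) (n : ℕ) :
    IsLevel (bar d γ n) (StaysBelow f lam n) := by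
  have key : ∀ x y, x ∈ rectAt d (bar d γ n) y → StaysBelow f lam n x → StaysBelow f lam n y := by
    intro x y hxy h m hm
    have hxy' := rectAt_anti (bar_mono hγ hm) y hxy
    refine ⟨?_, fun z hz => (h m hm).2 z (mem_rectAt_trans hz (mem_rectAt_comm.1 hxy'))⟩
    rw [← isLevel_F f m x y hxy']
    exact (h m hm).1
  exact fun x y hxy => propext ⟨key x y hxy, key y x (mem_rectAt_comm.1 hxy)⟩

open Classical in
/-- The martingale stopped just before it exceeds the threshold `lam`. -/
def truncMart (f : ConeMartingale d γ) (lam : ℝ) : ℕ → (Fin d → WG) → ℝ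
  | 0, x => if |f.F 0 x| ≤ lam then f.F 0 x else 0
  | n + 1, x => truncMart f lam n x + if StaysBelow f lam n x then f.F (n + 1) x - f.F n x else 0

lemma truncMart_eq_of_staysBelow {n : ℕ} {x : Fin d → WG} (h : StaysBelow f lam n x) :
    truncMart f lam n x = f.F n x := by
  induction n with
  | zero => rw [truncMart, if_pos (h 0 le_rfl).1]
  | succ n ih =>
    have h' := h.of_le (Nat.le_succ n)
    rw [truncMart, if_pos h', ih h']; ring

lemma truncMart_succ_eq_of_staysBelow {n : ℕ} {x : Fin d → WG} (h : StaysBelow f lam n x) :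
    truncMart f lam (n + 1) x = f.F (n + 1) x := by
  rw [truncMart, if_pos h, truncMart_eq_of_staysBelow h]; ring

lemma abs_truncMart_le (hl : 0 ≤ lam) (n : ℕ) (x : Fin d → WG) : |truncMart f lam n x| ≤ lam := by
  induction n with
  | zero => rw [truncMart]; split_ifs with h <;> simp [h, hl]
  | succ n ih =>
    by_cases h : StaysBelow f lam n x
    · rw [truncMart_succ_eq_of_staysBelow h]
      exact (h n le_rfl).2 x (mem_rectAt_self _ _)
    · rw [truncMart, if_neg h, add_zero]; exact ih

lemma isLevel_truncMart (hγ : IsCRF d γ) (lam : ℝ) (n : ℕ) :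
    IsLevel (bar d γ n) (truncMart f lam n) := by
  induction n with
  | zero => exact fun x y h => by simp only [truncMart, isLevel_F f 0 x y h]
  | succ n ih =>
    have hb := bar_mono hγ (Nat.le_succ n)
    intro x y h
    have h' := rectAt_anti hb y h
    have e := isLevel_staysBelow (f := f) hγ lam n x y h'
    by_cases hS : StaysBelow f lam n y <;>
      simp only [truncMart, ih x y h', e, hS, isLevel_F f n x y h', isLevel_F f (n + 1) x y h]

lemma setIntegral_truncMart_succ (hγ : IsCRF d γ) (lam : ℝ) {n m : ℕ} (hnm : n ≤ m)
    (y : Fin d → WG) : ∫ x in rectAt d (bar d γ n) y, truncMart f lam m x ∂μD d =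
      ∫ x in rectAt d (bar d γ n) y, truncMart f lam n x ∂μD d := by
  classical
  induction m, hnm using Nat.le_induction with
  | base => rfl
  | succ m hm ih =>
    set φ : (Fin d → WG) → ℝ := fun x =>
      if x ∈ rectAt d (bar d γ n) y ∧ StaysBelow f lam m x then 1 else 0 with hφ
    have hφl : IsLevel (bar d γ m) φ := by
      intro x z h
      have h' := rectAt_anti (bar_mono hγ hm) z h
      have e : x ∈ rectAt d (bar d γ n) y ↔ z ∈ rectAt d (bar d γ n) y :=
        ⟨mem_rectAt_trans (mem_rectAt_comm.1 h'), mem_rectAt_trans h'⟩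
      simp only [hφ, e, isLevel_staysBelow hγ lam m x z h]
    have hi : ∀ k, Integrable (fun x => φ x * f.F k x) (μD d) := fun k => by
      obtain ⟨B, hB⟩ := hφl.exists_abs_le
      exact (f.integrable k).bdd_mul (c := B) hφl.measurable.aestronglyMeasurable (ae_of_all _ hB)
    have hstep : ∫ x in rectAt d (bar d γ n) y,
        (truncMart f lam (m + 1) x - truncMart f lam m x) ∂μD d = 0 := by
      rw [← integral_indicator (measurableSet_rectAt _ _)]
      have : ∀ x, (rectAt d (bar d γ n) y).indicator
          (fun x => truncMart f lam (m + 1) x - truncMart f lam m x) x =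
          φ x * f.F (m + 1) x - φ x * f.F m x := by
        intro x
        by_cases h1 : x ∈ rectAt d (bar d γ n) y <;> by_cases h2 : StaysBelow f lam m x <;>
          simp [hφ, h1, h2, truncMart]
      simp only [this]
      rw [integral_sub (hi _) (hi _), integral_mul_F f (Nat.le_succ m) hφl, sub_self]
    rw [← ih, ← sub_eq_zero, ← integral_sub (isLevel_truncMart hγ lam _).integrable.integrableOn
      (isLevel_truncMart hγ lam _).integrable.integrableOn]
    exact hstep

/-- `n` is the first level at which the martingale fails to stay below `lam`. -/
def FirstExceeds (f : ConeMartingale d γ) (lam : ℝ) (n : ℕ) (x : Fin d → WG) : Prop :=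
  ¬StaysBelow f lam n x ∧ ∀ m < n, StaysBelow f lam m x

lemma FirstExceeds.unique {n m : ℕ} {x : Fin d → WG} (hn : FirstExceeds f lam n x)
    (hm : FirstExceeds f lam m x) : n = m := by
  rcases lt_trichotomy n m with h | h | h
  exacts [absurd (hm.2 n h) hn.1, h, absurd (hn.2 m h) hm.1]

lemma exists_firstExceeds {n : ℕ} {x : Fin d → WG} (h : ¬StaysBelow f lam n x) :
    ∃ m ≤ n, FirstExceeds f lam m x := by
  classical
  have hex : ∃ m, ¬StaysBelow f lam m x := ⟨n, h⟩
  exact ⟨Nat.find hex, Nat.find_min' hex h, Nat.find_spec hex,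
    fun m hm => not_not.1 (Nat.find_min hex hm)⟩

lemma isLevel_firstExceeds (hγ : IsCRF d γ) (lam : ℝ) (n : ℕ) :
    IsLevel (bar d γ n) (FirstExceeds f lam n) := by
  intro x y h
  have : (∀ m < n, StaysBelow f lam m x) = ∀ m < n, StaysBelow f lam m y :=
    propext (forall_congr' fun m => imp_congr_right fun hm => by
      rw [isLevel_staysBelow hγ lam m x y (rectAt_anti (bar_mono hγ hm.le) y h)])
  simp only [FirstExceeds, this, isLevel_staysBelow hγ lam n x y h]

/-- The difference of the stopped martingales at the thresholds `2 * lam` and `lam` has mean zero on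
each stopping rectangle. -/
lemma setIntegral_truncMart_sub_eq_zero (hγ : IsCRF d γ) (hl : 0 ≤ lam) {n m : ℕ} (hn : n ≠ 0)
    (hnm : n ≤ m) {y : Fin d → WG} (hy : FirstExceeds f lam n y) :
    ∫ x in rectAt d (bar d γ n) y, (truncMart f (2 * lam) m x - truncMart f lam m x) ∂μD d = 0 := by
  rw [integral_sub (isLevel_truncMart hγ _ _).integrable.integrableOn
    (isLevel_truncMart hγ _ _).integrable.integrableOn, setIntegral_truncMart_succ hγ _ hnm,
    setIntegral_truncMart_succ hγ _ hnm, sub_eq_zero]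
  refine setIntegral_congr_fun (measurableSet_rectAt _ _) fun x hx => ?_
  obtain ⟨k, rfl⟩ := Nat.exists_eq_succ_of_ne_zero hn
  have hx' : FirstExceeds f lam (k + 1) x := by rwa [isLevel_firstExceeds hγ lam _ x y hx]
  have h1 := hx'.2 k (Nat.lt_succ_self k)
  simp only [Nat.succ_eq_add_one]
  rw [truncMart_succ_eq_of_staysBelow h1,
    truncMart_succ_eq_of_staysBelow (h1.mono (by linarith))]

lemma measurable_martMaximal (f : ConeMartingale d γ) : Measurable (martMaximal d γ f) :=
  Measurable.iSup fun n => (isLevel_F f n).measurable.abs.ennreal_ofReal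

lemma lt_martMaximal (hl : 0 ≤ lam) {n : ℕ} {x : Fin d → WG} (h : lam < |f.F n x|) :
    ENNReal.ofReal lam < martMaximal d γ f x :=
  ((ENNReal.ofReal_lt_ofReal_iff (hl.trans_lt h)).2 h).trans_le
    (le_iSup (fun n => ENNReal.ofReal |f.F n x|) n)

/-- A stopping rectangle is comparable to its part where the maximal function is large. -/
lemma measure_rectAt_le_of_firstExceeds (hγ : IsCRF d γ) {s : ℕ}
    (hs : ∀ n₁ j, bar d γ (n₁ + 1) j ≤ bar d γ n₁ j + s) (hl : 0 ≤ lam) {n : ℕ} {y : Fin d → WG}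
    (hy : FirstExceeds f lam n y) : μD d (rectAt d (bar d γ n) y) ≤
      (2 ^ s) ^ d *
        μD d (rectAt d (bar d γ n) y ∩ {x | ENNReal.ofReal lam < martMaximal d γ f x}) := by
  have key : ∃ z ∈ rectAt d (bar d γ n) y, ∃ k ≤ n + 1, lam < |f.F k z| := by
    by_contra! hcon
    refine hy.1 fun m hm => ?_
    rcases hm.lt_or_eq with hm | rfl
    · exact hy.2 m hm m le_rfl
    · exact ⟨hcon y (mem_rectAt_self _ _) m (Nat.le_succ m), fun z hz => hcon z hz _ le_rfl⟩
  obtain ⟨z, hz, k, hk, hkz⟩ := key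
  have hsub : rectAt d (bar d γ (n + 1)) z ⊆
      rectAt d (bar d γ n) y ∩ {x | ENNReal.ofReal lam < martMaximal d γ f x} := fun x hx =>
    ⟨mem_rectAt_trans (rectAt_anti (bar_mono hγ (Nat.le_succ n)) z hx) hz,
      lt_martMaximal hl (n := k)
        (by rwa [isLevel_F f k x z (rectAt_anti (bar_mono hγ hk) z hx)])⟩
  refine le_trans ?_ (mul_le_mul_right (measure_mono hsub) _)
  have e : ((2 : ℝ≥0∞) ^ s) ^ d = ∏ _j : Fin d, (2 : ℝ≥0∞) ^ s := by simp
  rw [μD_rectAt, μD_rectAt, e, ← Finset.prod_mul_distrib]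
  refine Finset.prod_le_prod' fun j _ => ?_
  have h2 : (2 : ℝ≥0∞) * 2⁻¹ = 1 := ENNReal.mul_inv_cancel two_ne_zero ENNReal.ofNat_ne_top
  calc (2⁻¹ : ℝ≥0∞) ^ bar d γ n j = 2 ^ s * 2⁻¹ ^ (s + bar d γ n j) := by
        rw [pow_add, ← mul_assoc, ← mul_pow, h2, one_pow, one_mul]
    _ ≤ _ := by
        gcongr 2 ^ s * ?_
        exact pow_le_pow_right_of_le_one' (by simp) (by have := hs n j; omega)

end MartingaleDecomposition

end

noncomputable section

section HardyBound

variable {d : ℕ}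

open Classical in
lemma IsLevel.sum_ite_indicator {N : Fin d → ℕ} {M : Type*} [AddCommMonoid M]
    {P : (Fin d → WG) → Prop} (hP : IsLevel N P) (g : (Fin d → WG) → M) (x : Fin d → WG) :
    ∑ c, (if P (ofDigits N c) then (rectAt d N (ofDigits N c)).indicator g x else 0) =
      if P x then g x else 0 := by
  rw [Finset.sum_eq_single (digits N x)]
  · rw [Set.indicator_of_mem (mem_rectAt_ofDigits.2 rfl),
      hP x (ofDigits N (digits N x)) (mem_rectAt_ofDigits.2 rfl)]
  · intro c _ hc
    rw [Set.indicator_of_notMem (mt mem_rectAt_ofDigits.1 (Ne.symm hc)), ite_self]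
  · simp

lemma exists_sum_layers_le {p : ℝ} (hp : 0 < p) : ∃ A : ℝ≥0∞, A ≠ ⊤ ∧
    ∀ (ε : ℝ) (v : ℝ≥0∞) (k : ℕ), 0 < ε →
      ∑ i ∈ Finset.range k, (if ENNReal.ofReal (ε * 2 ^ i) < v
        then ENNReal.ofReal (ε * 2 ^ i) ^ p else 0) ≤ A * v ^ p := by
  obtain ⟨A, hA0, hA⟩ := exists_sum_rpow_le hp
  refine ⟨ENNReal.ofReal A, ENNReal.ofReal_ne_top, fun ε v k hε => ?_⟩
  induction k with
  | zero => simp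
  | succ k ih =>
    by_cases hk : ENNReal.ofReal (ε * 2 ^ k) < v
    · calc ∑ i ∈ Finset.range (k + 1), (if ENNReal.ofReal (ε * 2 ^ i) < v
            then ENNReal.ofReal (ε * 2 ^ i) ^ p else 0)
          ≤ ∑ i ∈ Finset.range (k + 1),
              ENNReal.ofReal ((ε * 2 ^ k) ^ p * 2 ^ (p * ((i : ℝ) - k))) := by
            refine Finset.sum_le_sum fun i _ => ?_
            split_ifs
            · rw [ENNReal.ofReal_rpow_of_nonneg (by positivity) hp.le,
                Real.mul_rpow hε.le (by positivity), Real.mul_rpow hε.le (by positivity),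
                ← Real.rpow_natCast_mul two_pos.le, ← Real.rpow_natCast_mul two_pos.le, mul_assoc,
                ← Real.rpow_add two_pos]
              ring_nf
              rfl
            · exact zero_le
        _ = ENNReal.ofReal ((ε * 2 ^ k) ^ p *
              ∑ i ∈ Finset.range (k + 1), 2 ^ (p * ((i : ℝ) - k))) := by
            rw [Finset.mul_sum, ENNReal.ofReal_sum_of_nonneg fun i _ => by positivity]
        _ ≤ ENNReal.ofReal ((ε * 2 ^ k) ^ p * A) := by
            have := hA k
            gcongr
        _ = ENNReal.ofReal A * ENNReal.ofReal (ε * 2 ^ k) ^ p := by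
            rw [mul_comm, ENNReal.ofReal_mul hA0,
              ENNReal.ofReal_rpow_of_nonneg (by positivity) hp.le]
        _ ≤ _ := by gcongr
    · rw [Finset.sum_range_succ, if_neg hk, add_zero]; exact ih

variable [NeZero d] {α : Fin d → ℝ} {γ : Fin d → ℝ → ℝ} {β : Fin d → ℝ}

lemma cesaroMaximal_sum_le {ι : Type*} (s : Finset ι) {b : ι → (Fin d → WG) → ℝ}
    (hb : ∀ i ∈ s, Integrable (b i) (μD d)) (x : Fin d → WG) :
    cesaroMaximal d α γ β (fCoeff d (∑ i ∈ s, b i)) x ≤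
      ∑ i ∈ s, cesaroMaximal d α γ β (fCoeff d (b i)) x := by
  classical
  induction s using Finset.induction_on with
  | empty => simp [cesaroMaximal_zero]
  | insert a s ha ih =>
    rw [Finset.sum_insert ha, Finset.sum_insert ha]
    have hs : ∀ i ∈ s, Integrable (b i) (μD d) := fun i hi => hb i (Finset.mem_insert_of_mem hi)
    exact (cesaroMaximal_add_le (hb a (Finset.mem_insert_self a s))
      (integrable_finsetSum' _ hs) x).trans (add_le_add_right (ih hs) _)

lemma lintegral_cesaroMaximal_sum_rpow_le {p : ℝ} (hp : 0 < p) (hp1 : p ≤ 1) {ι : Type*}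
    (s : Finset ι) {b : ι → (Fin d → WG) → ℝ} (hb : ∀ i ∈ s, Integrable (b i) (μD d)) :
    ∫⁻ x, cesaroMaximal d α γ β (fCoeff d (∑ i ∈ s, b i)) x ^ p ∂μD d ≤
      ∑ i ∈ s, ∫⁻ x, cesaroMaximal d α γ β (fCoeff d (b i)) x ^ p ∂μD d := by
  rw [← lintegral_finsetSum _ fun i _ => (measurable_cesaroMaximal _).pow_const p]
  exact lintegral_mono fun x => (ENNReal.rpow_le_rpow (cesaroMaximal_sum_le s hb x) hp.le).trans
    (rpow_sum_le_sum_rpow _ _ hp hp1)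

/-- The `L^p` estimate for the part of a martingale between the thresholds `lam` and `2 * lam`. -/
lemma lintegral_cesaroMaximal_layer_le (hγ : IsCRF d γ) {p : ℝ} (hp : 0 < p) (hp1 : p ≤ 1)
    {C : ℝ≥0∞} (hC : ∀ (n₁ : ℕ) (y : Fin d → WG) (b : (Fin d → WG) → ℝ) (lam : ℝ), Measurable b →
      (∀ x, |b x| ≤ lam) → (∀ x ∉ rectAt d (bar d γ n₁) y, b x = 0) →
      (n₁ = 0 ∨ ∫ x, b x ∂μD d = 0) →
      ∫⁻ x, cesaroMaximal d α γ β (fCoeff d b) x ^ p ∂μD d ≤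
        C * ENNReal.ofReal lam ^ p * μD d (rectAt d (bar d γ n₁) y))
    {s : ℕ} (hs : ∀ n₁ j, bar d γ (n₁ + 1) j ≤ bar d γ n₁ j + s) (f : ConeMartingale d γ) {lam : ℝ}
    (hl : 0 ≤ lam) (K : ℕ) :
    ∫⁻ x, cesaroMaximal d α γ β
        (fCoeff d (truncMart f (2 * lam) (K + 1) - truncMart f lam (K + 1))) x ^ p ∂μD d ≤
      C * ENNReal.ofReal 3 ^ p * (2 ^ s) ^ d * (ENNReal.ofReal lam ^ p *
        μD d {x | ENNReal.ofReal lam < martMaximal d γ f x}) := by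
  classical
  set h := truncMart f (2 * lam) (K + 1) - truncMart f lam (K + 1) with hh
  set A := {x | ENNReal.ofReal lam < martMaximal d γ f x} with hA
  have hAm : MeasurableSet A := measurableSet_lt measurable_const (measurable_martMaximal f)
  have hhm : Measurable h :=
    (isLevel_truncMart hγ _ _).measurable.sub (isLevel_truncMart hγ _ _).measurable
  have hhl : ∀ x, |h x| ≤ 3 * lam := fun x => by
    refine (abs_sub _ _).trans ?_
    have h1 := abs_truncMart_le (f := f) (lam := 2 * lam) (by linarith) (K + 1) x
    have h2 := abs_truncMart_le (f := f) hl (K + 1) x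
    linarith
  have hh0 : ∀ x, StaysBelow f lam K x → h x = 0 := fun x hx => by
    rw [hh, Pi.sub_apply, truncMart_succ_eq_of_staysBelow hx,
      truncMart_succ_eq_of_staysBelow (hx.mono (by linarith)), sub_self]
  set R : ∀ n, (∀ j, Fin (bar d γ n j) → ZMod 2) → Set (Fin d → WG) := fun n c =>
    rectAt d (bar d γ n) (ofDigits (bar d γ n) c) with hR
  have hRm : ∀ n c, MeasurableSet (R n c) := fun n c => measurableSet_rectAt _ _
  set b : ∀ n, (∀ j, Fin (bar d γ n j) → ZMod 2) → (Fin d → WG) → ℝ := fun n c x =>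
    if FirstExceeds f lam n (ofDigits (bar d γ n) c) then (R n c).indicator h x else 0 with hb
  have hbm : ∀ n c, Measurable (b n c) := fun n c =>
    Measurable.ite (MeasurableSet.const _) (hhm.indicator (hRm n c)) measurable_const
  have hbl : ∀ n c x, |b n c x| ≤ 3 * lam := fun n c x => by
    have h0 : |(0 : ℝ)| ≤ 3 * lam := by rw [abs_zero]; positivity
    simp only [hb, Set.indicator_apply]
    split_ifs
    exacts [hhl x, h0, h0]
  have hbi : ∀ n c, Integrable (b n c) (μD d) := fun n c =>
    Integrable.of_bound (hbm n c).aestronglyMeasurable _ (ae_of_all _ (hbl n c))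
  have hsum : h = ∑ n ∈ Finset.range (K + 1), ∑ c, b n c := by
    ext x
    simp only [Finset.sum_apply, hb, hR]
    rw [Finset.sum_congr rfl fun n _ => (isLevel_firstExceeds hγ lam n).sum_ite_indicator h x]
    by_cases hx : StaysBelow f lam K x
    · simp [hh0 x hx]
    · obtain ⟨n, hn, hnx⟩ := exists_firstExceeds hx
      rw [Finset.sum_eq_single_of_mem n (Finset.mem_range.2 (Nat.lt_succ_of_le hn)), if_pos hnx]
      exact fun m _ hm => if_neg fun hmx => hm (hmx.unique hnx)
  have hatom : ∀ n ∈ Finset.range (K + 1), ∀ c,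
      ∫⁻ x, cesaroMaximal d α γ β (fCoeff d (b n c)) x ^ p ∂μD d ≤
        C * ENNReal.ofReal (3 * lam) ^ p * ((2 ^ s) ^ d * ∫⁻ x,
          (if FirstExceeds f lam n (ofDigits (bar d γ n) c)
            then (R n c).indicator (A.indicator 1) x else 0) ∂μD d) := by
    intro n hn c
    by_cases hF : FirstExceeds f lam n (ofDigits (bar d γ n) c)
    · simp only [if_pos hF]
      rw [lintegral_indicator (hRm n c), lintegral_indicator_one hAm, Measure.restrict_apply hAm,
        Set.inter_comm]
      refine (hC n (ofDigits (bar d γ n) c) (b n c) (3 * lam) (hbm n c) (hbl n c)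
        (fun x hx => by simp only [hb, if_pos hF]; exact Set.indicator_of_notMem hx _)
        ?_).trans ?_
      · refine or_iff_not_imp_left.2 fun hn0 => ?_
        simp only [hb, if_pos hF]
        rw [integral_indicator (hRm n c)]
        exact setIntegral_truncMart_sub_eq_zero hγ hl hn0 (Finset.mem_range.1 hn).le hF
      · gcongr
        exact measure_rectAt_le_of_firstExceeds hγ hs hl hF
    · have : b n c = 0 := by ext x; simp [hb, hF]
      simp [this, cesaroMaximal_zero, hp]
  have hdisj : ∀ x, ∑ n ∈ Finset.range (K + 1), ∑ c,
      (if FirstExceeds f lam n (ofDigits (bar d γ n) c)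
        then (R n c).indicator (A.indicator (1 : (Fin d → WG) → ℝ≥0∞)) x else 0) ≤
      A.indicator 1 x := by
    intro x
    simp only [hR]
    rw [Finset.sum_congr rfl fun n _ =>
      (isLevel_firstExceeds hγ lam n).sum_ite_indicator (A.indicator 1) x]
    by_cases hx : ∃ n, FirstExceeds f lam n x
    · obtain ⟨n, hn⟩ := hx
      refine le_trans (Finset.sum_le_sum fun m _ =>
        (?_ : _ ≤ if m = n then A.indicator (1 : (Fin d → WG) → ℝ≥0∞) x else 0)) ?_
      · split_ifs with h1 h2 h3
        exacts [le_rfl, absurd (h1.unique hn) h2, zero_le, le_rfl]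
      · rw [Finset.sum_ite_eq']
        split_ifs
        exacts [le_rfl, zero_le]
    · simp only [not_exists] at hx
      simp [hx]
  have hχm : ∀ n c, Measurable fun x => (if FirstExceeds f lam n (ofDigits (bar d γ n) c)
      then (R n c).indicator (A.indicator (1 : (Fin d → WG) → ℝ≥0∞)) x else 0) := fun n c =>
    Measurable.ite (MeasurableSet.const _) ((measurable_one.indicator hAm).indicator (hRm n c))
      measurable_const
  calc ∫⁻ x, cesaroMaximal d α γ β (fCoeff d h) x ^ p ∂μD d
      ≤ ∑ n ∈ Finset.range (K + 1), ∑ c,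
          ∫⁻ x, cesaroMaximal d α γ β (fCoeff d (b n c)) x ^ p ∂μD d := by
        rw [hsum]
        exact (lintegral_cesaroMaximal_sum_rpow_le hp hp1 _ fun n _ =>
          integrable_finsetSum' _ fun c _ => hbi n c).trans (Finset.sum_le_sum fun n _ =>
            lintegral_cesaroMaximal_sum_rpow_le hp hp1 _ fun c _ => hbi n c)
    _ ≤ ∑ n ∈ Finset.range (K + 1), ∑ c, C * ENNReal.ofReal (3 * lam) ^ p * ((2 ^ s) ^ d * ∫⁻ x,
          (if FirstExceeds f lam n (ofDigits (bar d γ n) c)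
            then (R n c).indicator (A.indicator 1) x else 0) ∂μD d) :=
        Finset.sum_le_sum fun n hn => Finset.sum_le_sum fun c _ => hatom n hn c
    _ = C * ENNReal.ofReal (3 * lam) ^ p * ((2 ^ s) ^ d *
          ∫⁻ x, ∑ n ∈ Finset.range (K + 1), ∑ c,
            (if FirstExceeds f lam n (ofDigits (bar d γ n) c)
              then (R n c).indicator (A.indicator 1) x else 0) ∂μD d) := by
        rw [lintegral_finsetSum _ fun n _ => Finset.measurable_fun_sum _ fun c _ => hχm n c]
        simp only [lintegral_finsetSum _ fun c _ => hχm _ c, Finset.mul_sum]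
    _ ≤ C * ENNReal.ofReal (3 * lam) ^ p * ((2 ^ s) ^ d * ∫⁻ x, A.indicator 1 x ∂μD d) := by
        gcongr with x
        exact hdisj x
    _ = _ := by
        rw [lintegral_indicator_one hAm, ENNReal.ofReal_mul (by norm_num),
          ENNReal.mul_rpow_of_nonneg _ _ hp.le]
        ring

/-- Uniform `L^p` estimate for the terms of a martingale. -/
lemma exists_lintegral_cesaroMaximal_F_le (hα : ∀ i, 0 < α i ∧ α i ≤ 1) (hγ : IsCRF d γ)
    (hβ : ∀ j, j ≠ 0 → 1 ≤ β j) {p : ℝ} (hp : 0 < p) (hp1 : p ≤ 1)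
    (hαp : ∀ i, 1 < α i * p + p) : ∃ C : ℝ≥0∞, C ≠ ⊤ ∧ ∀ (f : ConeMartingale d γ) (K : ℕ),
      ∫⁻ x, cesaroMaximal d α γ β (fCoeff d (f.F (K + 1))) x ^ p ∂μD d ≤
        C * ∫⁻ x, martMaximal d γ f x ^ p ∂μD d := by
  obtain ⟨C, hCtop, hC⟩ := exists_lintegral_cesaroMaximal_le hα hγ hβ hp hp1 hαp
  obtain ⟨s, hs⟩ := exists_bar_succ_le hγ
  obtain ⟨A, hAtop, hA⟩ := exists_sum_layers_le hp
  set C' := C * ENNReal.ofReal 3 ^ p * (2 ^ s) ^ d with hC'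
  have hC'top : C' ≠ ⊤ := ENNReal.mul_ne_top (ENNReal.mul_ne_top hCtop
    (ENNReal.rpow_ne_top_of_nonneg hp.le ENNReal.ofReal_ne_top)) (by finiteness)
  refine ⟨C' * A, ENNReal.mul_ne_top hC'top hAtop, fun f K => ?_⟩
  have key : ∀ ε : ℝ, 0 < ε →
      ∫⁻ x, cesaroMaximal d α γ β (fCoeff d (f.F (K + 1))) x ^ p ∂μD d ≤
        C * ENNReal.ofReal ε ^ p + C' * A * ∫⁻ x, martMaximal d γ f x ^ p ∂μD d := by
    intro ε hε
    choose B hB using fun m => (isLevel_F f m).exists_abs_le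
    obtain ⟨k, hk⟩ : ∃ k : ℕ, ∀ m ≤ K + 1, ∀ x, |f.F m x| ≤ ε * 2 ^ k := by
      have hsum : ∀ m ≤ K + 1, B m ≤ ∑ i ∈ Finset.range (K + 2), |B i| := fun m hm =>
        (le_abs_self _).trans (Finset.single_le_sum (f := fun i => |B i|)
          (fun i _ => abs_nonneg _) (Finset.mem_range.2 (Nat.lt_succ_of_le hm)))
      obtain ⟨k, hk⟩ := pow_unbounded_of_one_lt
        ((∑ i ∈ Finset.range (K + 2), |B i|) / ε) _root_.one_lt_two
      refine ⟨k, fun m hm x => (hB m x).trans ((hsum m hm).trans ?_)⟩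
      rw [mul_comm]
      exact ((div_lt_iff₀ hε).1 hk).le
    set g : ℕ → (Fin d → WG) → ℝ := fun i => truncMart f (ε * 2 ^ i) (K + 1) with hg
    have hgi : ∀ i, Integrable (g i) (μD d) := fun i => (isLevel_truncMart hγ _ _).integrable
    have hgk : f.F (K + 1) = g 0 + ∑ i ∈ Finset.range k, (g (i + 1) - g i) := by
      rw [Finset.sum_range_sub]
      have : g k = f.F (K + 1) := funext fun x => truncMart_succ_eq_of_staysBelow fun m hm =>
        ⟨hk m (by omega) x, fun y _ => hk (m + 1) (by omega) y⟩
      rw [this]; abel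
    have hlayer : ∀ i, ∫⁻ x, cesaroMaximal d α γ β (fCoeff d (g (i + 1) - g i)) x ^ p ∂μD d ≤
        C' * ∫⁻ x, (if ENNReal.ofReal (ε * 2 ^ i) < martMaximal d γ f x
          then ENNReal.ofReal (ε * 2 ^ i) ^ p else 0) ∂μD d := by
      intro i
      have h1 := lintegral_cesaroMaximal_layer_le (α := α) (β := β) hγ hp hp1 hC hs f
        (lam := ε * 2 ^ i) (by positivity) K
      rw [show 2 * (ε * 2 ^ i) = ε * 2 ^ (i + 1) by ring] at h1
      refine h1.trans_eq ?_
      congr 1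
      have hm : MeasurableSet {x | ENNReal.ofReal (ε * 2 ^ i) < martMaximal d γ f x} :=
        measurableSet_lt measurable_const (measurable_martMaximal f)
      rw [← lintegral_indicator_const hm]
      refine lintegral_congr fun x => ?_
      by_cases hx : ENNReal.ofReal (ε * 2 ^ i) < martMaximal d γ f x <;>
        simp [Set.indicator, hx]
    have hg0 : ∫⁻ x, cesaroMaximal d α γ β (fCoeff d (g 0)) x ^ p ∂μD d ≤
        C * ENNReal.ofReal ε ^ p := by
      have h1 := hC 0 0 (g 0) ε (isLevel_truncMart hγ _ _).measurable
        (fun x => by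
          have := abs_truncMart_le (f := f) (lam := ε * 2 ^ 0) (by positivity) (K + 1) x
          simpa only [hg, pow_zero, mul_one] using this)
        (fun x hx => absurd (fun j i hi => by rw [bar_zero hγ] at hi; omega) hx) (Or.inl rfl)
      exact h1.trans (mul_le_of_le_one_right' prob_le_one)
    calc ∫⁻ x, cesaroMaximal d α γ β (fCoeff d (f.F (K + 1))) x ^ p ∂μD d
        ≤ ∫⁻ x, (cesaroMaximal d α γ β (fCoeff d (g 0)) x ^ p + cesaroMaximal d α γ β
            (fCoeff d (∑ i ∈ Finset.range k, (g (i + 1) - g i))) x ^ p) ∂μD d := by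
          rw [hgk]
          exact lintegral_mono fun x => (ENNReal.rpow_le_rpow (cesaroMaximal_add_le (hgi 0)
            (integrable_finsetSum' _ fun i _ => (hgi _).sub (hgi _)) x) hp.le).trans
            (ENNReal.rpow_add_le_add_rpow _ _ hp.le hp1)
      _ ≤ C * ENNReal.ofReal ε ^ p + ∑ i ∈ Finset.range k, C' * ∫⁻ x,
            (if ENNReal.ofReal (ε * 2 ^ i) < martMaximal d γ f x
              then ENNReal.ofReal (ε * 2 ^ i) ^ p else 0) ∂μD d := by
          rw [lintegral_add_left ((measurable_cesaroMaximal _).pow_const p)]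
          exact add_le_add hg0 ((lintegral_cesaroMaximal_sum_rpow_le hp hp1 _ fun i _ =>
            (hgi _).sub (hgi _)).trans (Finset.sum_le_sum fun i _ => hlayer i))
      _ = C * ENNReal.ofReal ε ^ p + C' * ∫⁻ x, ∑ i ∈ Finset.range k,
            (if ENNReal.ofReal (ε * 2 ^ i) < martMaximal d γ f x
              then ENNReal.ofReal (ε * 2 ^ i) ^ p else 0) ∂μD d := by
          rw [lintegral_finsetSum, Finset.mul_sum]
          exact fun i _ => Measurable.ite
            (measurableSet_lt measurable_const (measurable_martMaximal f)) measurable_const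
            measurable_const
      _ ≤ C * ENNReal.ofReal ε ^ p + C' * ∫⁻ x, A * martMaximal d γ f x ^ p ∂μD d := by
          gcongr with x
          exact hA ε _ k hε
      _ = _ := by
          rw [lintegral_const_mul _ ((measurable_martMaximal f).pow_const p), mul_assoc C']
  have hlim : Tendsto (fun n : ℕ => C * ENNReal.ofReal (1 / ((n : ℝ) + 1)) ^ p +
      C' * A * ∫⁻ x, martMaximal d γ f x ^ p ∂μD d) atTop
      (nhds (C * 0 + C' * A * ∫⁻ x, martMaximal d γ f x ^ p ∂μD d)) := by
    refine Tendsto.add_const _ (ENNReal.Tendsto.const_mul ?_ (Or.inr hCtop))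
    have h1 : Tendsto (fun n : ℕ => ENNReal.ofReal (1 / ((n : ℝ) + 1))) atTop (nhds 0) := by
      rw [← ENNReal.ofReal_zero]
      exact ENNReal.tendsto_ofReal tendsto_one_div_add_atTop_nhds_zero_nat
    have h2 := ((ENNReal.continuous_rpow_const (y := p)).tendsto 0).comp h1
    rwa [ENNReal.zero_rpow_of_pos hp] at h2
  rw [mul_zero, zero_add] at hlim
  exact ge_of_tendsto' hlim fun n => key _ (by positivity)

lemma cesaroMaximal_martCoeff_rpow_le_liminf (hγ : IsCRF d γ) {p : ℝ} (hp : 0 < p)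
    (f : ConeMartingale d γ) (x : Fin d → WG) :
    cesaroMaximal d α γ β (martCoeff d γ f) x ^ p ≤
      liminf (fun K => cesaroMaximal d α γ β (fCoeff d (f.F (K + 1))) x ^ p) atTop := by
  rw [← ENNReal.le_rpow_inv_iff hp]
  refine iSup₂_le fun n hn => ?_
  rw [ENNReal.le_rpow_inv_iff hp]
  obtain ⟨K, hK⟩ := exists_le_two_pow_bar hγ (∑ j, n j + 1)
  refine le_liminf_of_le (by isBoundedDefault) ?_
  filter_upwards [eventually_ge_atTop K] with k hk
  have hcoeff : cesaroOf d α (martCoeff d γ f) n x = cesaroOf d α (fCoeff d (f.F (k + 1))) n x := by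
    unfold cesaroOf partialSumOf
    congr 1
    refine Finset.sum_congr rfl fun i hi => ?_
    congr 1
    refine Finset.sum_congr rfl fun m hm => ?_
    rw [martCoeff_eq f (K := k + 1) fun j => ?_]
    have h1 := Finset.mem_range.1 (Fintype.mem_piFinset.1 hi j)
    have h2 := Finset.mem_range.1 (Fintype.mem_piFinset.1 hm j)
    have h3 := Finset.single_le_sum (f := n) (fun _ _ => Nat.zero_le _) (Finset.mem_univ j)
    have h4 := (hK j).trans (Nat.pow_le_pow_right two_pos (bar_mono hγ (show K ≤ k + 1 by omega) j))
    omega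
  rw [hcoeff]
  exact ENNReal.rpow_le_rpow (le_iSup₂_of_le n hn le_rfl) hp.le

end HardyBound

end

noncomputable section

/-- Theorem 1 + Weisz's Lemma: the cone-like restricted maximal operator
`σ_L^{κ,α,*}` of the `d`-dimensional Walsh–Kaczmarz `(C,α)` means is bounded from the
martingale Hardy space `H_p^γ` to `L_p` for `p₀ < p ≤ 1`, `p₀ = max_i 1/(1+α_i)`. -/
theorem cesaroMaximal_bounded_hardy
    (d : ℕ) (α : Fin (d + 1) → ℝ) (hα : ∀ i, 0 < α i ∧ α i ≤ 1)
    (γ : Fin (d + 1) → ℝ → ℝ) (hγ : IsCRF (d + 1) γ)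
    (β : Fin (d + 1) → ℝ) (hβ : ∀ j : Fin (d + 1), j ≠ 0 → 1 ≤ β j)
    (p : ℝ) (hp₁ : Finset.univ.sup' Finset.univ_nonempty (fun i => 1 / (1 + α i)) < p)
    (hp₂ : p ≤ 1) :
    ∃ C : ℝ≥0∞, C ≠ ⊤ ∧ ∀ f : ConeMartingale (d + 1) γ,
      hardyNorm (d + 1) γ p f ≠ ⊤ →
      lpNormE (d + 1) p (cesaroMaximal (d + 1) α γ β (martCoeff (d + 1) γ f))
        ≤ C * hardyNorm (d + 1) γ p f := by
  have hαp : ∀ i, 1 < α i * p + p := fun i => by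
    have h1 := (Finset.sup'_lt_iff _).1 hp₁ i (Finset.mem_univ i)
    rw [div_lt_iff₀ (by linarith [(hα i).1])] at h1
    linarith
  have hp : 0 < p := lt_of_le_of_lt (by have := (hα 0).1; positivity)
    ((Finset.sup'_lt_iff _).1 hp₁ 0 (Finset.mem_univ 0))
  obtain ⟨C, hC, hCf⟩ := exists_lintegral_cesaroMaximal_F_le hα hγ hβ hp hp₂ hαp
  refine ⟨C ^ (1 / p), ENNReal.rpow_ne_top_of_nonneg (by positivity) hC, fun f _ => ?_⟩
  have hmain : ∫⁻ x, cesaroMaximal (d + 1) α γ β (martCoeff (d + 1) γ f) x ^ p ∂μD (d + 1) ≤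
      C * ∫⁻ x, martMaximal (d + 1) γ f x ^ p ∂μD (d + 1) :=
    calc _ ≤ _ := lintegral_mono fun x => cesaroMaximal_martCoeff_rpow_le_liminf hγ hp f x
      _ ≤ _ := lintegral_liminf_le fun K => (measurable_cesaroMaximal _).pow_const p
      _ ≤ liminf (fun _ : ℕ => C * ∫⁻ x, martMaximal (d + 1) γ f x ^ p ∂μD (d + 1)) atTop :=
        liminf_le_liminf (Eventually.of_forall fun K => hCf f K)
      _ = _ := liminf_const _
  unfold hardyNorm lpNormE
  rw [← ENNReal.mul_rpow_of_nonneg _ _ (by positivity : 0 ≤ 1 / p)]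
  exact ENNReal.rpow_le_rpow hmain (by positivity)

end
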